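/- Let T be an expanding Markov map with repeller Λ and let φ : Λ → ℝ be a non-negative potential satisfying the tempered distortion condition. Then for every y ∈ Λ, the Hausdorff dimension of the shrinking target set satisfies dim D_y(φ) = s(φ). -/

import Mathlib

open Set Filter Topology

/-- An expanding Markov map with countably many inverse branches: a countable family
`{V i}` of pairwise disjoint subintervals of `[0,1]` with nonempty interior, and a map `T`
(given here as a global function `ℝ → ℝ`, only its behaviour on `⋃ i, V i` matters) which is
`C¹` on each `V i` with derivative `T'`, maps the interior of each `V i` onto `(0,1)`, is
uniformly expanding, and has tempered distortion of the derivative. -/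
structure ExpandingMarkovMap (A : Type) : Type where
  countable : Countable A
  nontriv : ∃ i j : A, i ≠ j
  V : A → Set ℝ
  T : ℝ → ℝ
  T' : ℝ → ℝ
  V_subset : ∀ i, V i ⊆ Icc (0:ℝ) 1
  V_ordConnected : ∀ i, (V i).OrdConnected
  V_interior_nonempty : ∀ i, (interior (V i)).Nonempty
  V_disjoint : Pairwise (Function.onFun Disjoint V)
  T_mapsTo : ∀ i, MapsTo T (V i) (Icc (0:ℝ) 1)
  T_C1 : ∀ i, ContDiffOn ℝ 1 T (V i)
  T_hasDeriv : ∀ i, ∀ x ∈ V i, HasDerivWithinAt T (T' x) (V i) x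
  T_maps_interior : ∀ i, T '' interior (V i) = Ioo (0:ℝ) 1
  expanding : ∃ ξ > (1:ℝ), ∃ N : ℕ, ∀ n, N ≤ n → ∀ ω : Fin n → A, ∀ x : ℝ,
    (∀ ν : Fin n, T^[(ν : ℕ)] x ∈ V (ω ν)) →
    ξ ^ n < ∏ l ∈ Finset.range n, |T' (T^[l] x)|
  distortion : ∃ ρ : ℕ → ℝ, Tendsto ρ atTop (𝓝 0) ∧
    ∀ n : ℕ, ∀ ω : Fin n → A, ∀ x y : ℝ,
      (∀ ν : Fin n, T^[(ν : ℕ)] x ∈ V (ω ν)) → (∀ ν : Fin n, T^[(ν : ℕ)] y ∈ V (ω ν)) →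
      Real.exp (-(n : ℝ) * ρ n) ≤
          (∏ l ∈ Finset.range n, |T' (T^[l] x)|) / (∏ l ∈ Finset.range n, |T' (T^[l] y)|) ∧
        (∏ l ∈ Finset.range n, |T' (T^[l] x)|) / (∏ l ∈ Finset.range n, |T' (T^[l] y)|) ≤
          Real.exp ((n : ℝ) * ρ n)

namespace ExpandingMarkovMap

variable {A : Type} (M : ExpandingMarkovMap A)

/-- The cylinder `V_ω = ⋂_{ν<n} T^{-ν}(V_{ω_ν})` associated to a word `ω ∈ A^n`. -/
def cylinder {n : ℕ} (ω : Fin n → A) : Set ℝ :=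
  {x | ∀ ν : Fin n, M.T^[(ν : ℕ)] x ∈ M.V (ω ν)}

/-- The repeller `Λ`: the set of points all of whose iterates are well defined. -/
def repeller : Set ℝ := {x | ∀ n : ℕ, M.T^[n] x ∈ ⋃ i, M.V i}

/-- The Birkhoff sum `S_n(f)(x) = ∑_{l<n} f(T^l x)`. -/
def birkhoff (f : ℝ → ℝ) (n : ℕ) (x : ℝ) : ℝ := ∑ l ∈ Finset.range n, f (M.T^[l] x)

/-- `S_n(f)(ω) = sup { S_n(f)(x) : x ∈ V_ω }` (`f` being a potential on `Λ`). -/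
noncomputable def birkhoffSup (f : ℝ → ℝ) {n : ℕ} (ω : Fin n → A) : ℝ :=
  sSup {v | ∃ x ∈ M.cylinder ω ∩ M.repeller, v = M.birkhoff f n x}

/-- The set of values `|f x - f y|` over pairs `x, y` in a common `n`-cylinder. -/
def varSet (f : ℝ → ℝ) (n : ℕ) : Set ℝ :=
  {d | ∃ ω : Fin n → A, ∃ x ∈ M.cylinder ω ∩ M.repeller, ∃ y ∈ M.cylinder ω ∩ M.repeller,
    d = |f x - f y|}

/-- The `n`-th level variation `var_n(f)`. -/
noncomputable def var (f : ℝ → ℝ) (n : ℕ) : ℝ := sSup (M.varSet f n)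

/-- The tempered distortion condition for a potential on `Λ`:
`var_1(f) < ∞` and `n⁻¹ var_n(S_n(f)) → 0`. -/
def Tempered (f : ℝ → ℝ) : Prop :=
  BddAbove (M.varSet f 1) ∧
    Tendsto (fun n : ℕ => M.var (M.birkhoff f n) n / (n : ℝ)) atTop (𝓝 0)

/-- The topological pressure `P(f) = lim_n n⁻¹ log ∑_{ω ∈ Aⁿ} exp S_n(f)(ω)`
(realised as a `limsup` in `EReal`; the limit exists for tempered potentials). -/
noncomputable def pressure (f : ℝ → ℝ) : EReal :=
  limsup (fun n : ℕ =>
    ((1 / (n : ℝ) : ℝ) : EReal) *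
      ENNReal.log (∑' ω : Fin n → A, ENNReal.ofReal (Real.exp (M.birkhoffSup f ω)))) atTop

/-- The potential `ψ = log |T'|`. -/
noncomputable def psi : ℝ → ℝ := fun x => Real.log |M.T' x|

/-- `s(φ) = inf { s : P(-s(ψ+φ)) ≤ 0 }`. -/
noncomputable def sdim (φ : ℝ → ℝ) : ℝ :=
  sInf {s : ℝ | M.pressure (fun x => -s * (M.psi x + φ x)) ≤ 0}

/-- The shrinking target set `D_y(φ)`. -/
def shrinkingTarget (y : ℝ) (φ : ℝ → ℝ) : Set ℝ :=
  ⋂ m : ℕ, ⋃ n : ℕ, ⋃ _ : m ≤ n,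
    {x | x ∈ M.repeller ∧ |M.T^[n] x - y| < Real.exp (-(M.birkhoff φ n x))}

/-- The shrinking target set `S_y(Φ)` for a sequence of radii `Φ`. -/
def shrinkingTargetSeq (y : ℝ) (Φ : ℕ → ℝ) : Set ℝ :=
  ⋂ m : ℕ, ⋃ n : ℕ, ⋃ _ : m ≤ n, {x | x ∈ M.repeller ∧ |M.T^[n] x - y| < Φ n}

/-- `g` is the iterated function system associated to `M`: `g i` is the inverse branch of
`T` on `V i`, a `C¹` map of `[0,1]` into `closure (V i)` with `g i (T x) = x` on `V i`. -/
def IsIFS (g : A → ℝ → ℝ) : Prop :=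
  ∀ i, ContDiffOn ℝ 1 (g i) (Icc (0:ℝ) 1) ∧ MapsTo (g i) (Icc (0:ℝ) 1) (closure (M.V i)) ∧
    ∀ x ∈ M.V i, g i (M.T x) = x

end ExpandingMarkovMap

/-- The composition `φ_τ = φ_{τ_1} ∘ ⋯ ∘ φ_{τ_n}` of the maps of an IFS along a word `τ`. -/
def ifsWord {A : Type} (g : A → ℝ → ℝ) {n : ℕ} (τ : Fin n → A) : ℝ → ℝ :=
  (List.ofFn fun ν : Fin n => g (τ ν)).foldr (· ∘ ·) id

/-- `C(y,n,r)`: the collection of cylinder sets `φ_τ([0,1])`, `τ ∈ Aⁿ`, contained in `B(y,r)`. -/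
def cylinderFamily {A : Type} (g : A → ℝ → ℝ) (y : ℝ) (n : ℕ) (r : ℝ) : Set (Set ℝ) :=
  {S | ∃ τ : Fin n → A, S = ifsWord g τ '' Icc (0:ℝ) 1 ∧ S ⊆ Metric.ball y r}

/-- Positive upper cylinder density of the IFS `g` at `y`. -/
def HasPUCD {A : Type} (g : A → ℝ → ℝ) (y : ℝ) : Prop :=
  ∃ lam : ℝ → ℕ,
    Tendsto lam (𝓝[>] (0:ℝ)) atTop ∧
    limsup (fun r : ℝ => Real.log r / (lam r : ℝ)) (𝓝[>] (0:ℝ)) < 0 ∧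
    0 < limsup (fun r : ℝ =>
        (ENNReal.ofReal r)⁻¹ * ∑' S : cylinderFamily g y (lam r) r, EMetric.diam (S : Set ℝ))
      (𝓝[>] (0:ℝ))

theorem Set.OrdConnected.exists_deriv_mul_sub {S : Set ℝ} (hS : S.OrdConnected) {f f' : ℝ → ℝ}
    (hf : ∀ x ∈ S, HasDerivWithinAt f (f' x) S x) {x y : ℝ} (hx : x ∈ S) (hy : y ∈ S) :
    ∃ c ∈ S, f y - f x = f' c * (y - x) := by
  have key : ∀ x ∈ S, ∀ y ∈ S, x < y → ∃ c ∈ S, f y - f x = f' c * (y - x) := by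
    intro x hx y hy hxy
    have hsub : Icc x y ⊆ S := hS.out hx hy
    obtain ⟨c, hc, h⟩ := exists_hasDerivAt_eq_slope f f' hxy
      (fun z hz => (hf z (hsub hz)).continuousWithinAt.mono hsub)
      (fun z hz => (hf z (hsub (Ioo_subset_Icc_self hz))).hasDerivAt
        (mem_of_superset (Icc_mem_nhds hz.1 hz.2) hsub))
    refine ⟨c, hsub (Ioo_subset_Icc_self hc), ?_⟩
    rw [h, div_mul_cancel₀ _ (sub_ne_zero.2 hxy.ne')]
  rcases lt_trichotomy x y with h | h | h
  · exact key x hx y hy h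
  · exact ⟨x, hx, by simp [h]⟩
  · obtain ⟨c, hc, e⟩ := key y hy x hx h
    exact ⟨c, hc, by linarith⟩

theorem Set.OrdConnected.strictMonoOn_or_strictAntiOn {S : Set ℝ} (hS : S.OrdConnected)
    {f f' : ℝ → ℝ} (hf : ∀ x ∈ S, HasDerivWithinAt f (f' x) S x) (h0 : ∀ x ∈ S, f' x ≠ 0) :
    StrictMonoOn f S ∨ StrictAntiOn f S := by
  rcases hasDerivWithinAt_forall_lt_or_forall_gt_of_forall_ne hS.convex hf h0 with h | h
  · right
    intro x hx y hy hxy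
    obtain ⟨c, hc, e⟩ := hS.exists_deriv_mul_sub hf hx hy
    nlinarith [h c hc]
  · left
    intro x hx y hy hxy
    obtain ⟨c, hc, e⟩ := hS.exists_deriv_mul_sub hf hx hy
    nlinarith [h c hc]

theorem Set.OrdConnected.inter_preimage {S I : Set ℝ} (hS : S.OrdConnected) (hI : I.OrdConnected)
    {f : ℝ → ℝ} (hf : StrictMonoOn f S ∨ StrictAntiOn f S) : (S ∩ f ⁻¹' I).OrdConnected := by
  refine ⟨fun x hx y hy z hz => ?_⟩
  have hzS : z ∈ S := hS.out hx.1 hy.1 hz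
  refine ⟨hzS, ?_⟩
  rcases hf with h | h
  · exact hI.out hx.2 hy.2 ⟨h.monotoneOn hx.1 hzS hz.1, h.monotoneOn hzS hy.1 hz.2⟩
  · exact hI.out hy.2 hx.2 ⟨h.antitoneOn hzS hy.1 hz.2, h.antitoneOn hx.1 hzS hz.1⟩

/-- Among three pairwise disjoint intervals, one lies between points of the other two. -/
theorem exists_subset_Ioo_of_pairwise_disjoint {S₁ S₂ S₃ : Set ℝ} (h₁ : S₁.OrdConnected)
    (h₂ : S₂.OrdConnected) (h₃ : S₃.OrdConnected) (h₁₂ : Disjoint S₁ S₂) (h₁₃ : Disjoint S₁ S₃)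
    (h₂₃ : Disjoint S₂ S₃) {p₁ p₂ p₃ : ℝ} (m₁ : p₁ ∈ S₁) (m₂ : p₂ ∈ S₂) (m₃ : p₃ ∈ S₃) :
    ∃ a ∈ ({p₁, p₂, p₃} : Set ℝ), ∃ b ∈ ({p₁, p₂, p₃} : Set ℝ),
      S₁ ⊆ Ioo a b ∨ S₂ ⊆ Ioo a b ∨ S₃ ⊆ Ioo a b := by
  have key : ∀ {S R T : Set ℝ} {p q r : ℝ}, S.OrdConnected → Disjoint S R → Disjoint S T →
      p ∈ S → q ∈ R → r ∈ T → q < p → p < r → S ⊆ Ioo q r := by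
    intro S R T p q r hS hR hT hp hq hr h1 h2 z hz
    constructor
    · by_contra! h
      exact disjoint_left.1 hR (hS.out hz hp ⟨h, h1.le⟩) hq
    · by_contra! h
      exact disjoint_left.1 hT (hS.out hp hz ⟨h2.le, h⟩) hr
  have n₁₂ : p₁ ≠ p₂ := h₁₂.ne_of_mem m₁ m₂
  have n₁₃ : p₁ ≠ p₃ := h₁₃.ne_of_mem m₁ m₃
  have n₂₃ : p₂ ≠ p₃ := h₂₃.ne_of_mem m₂ m₃
  rcases lt_or_gt_of_ne n₁₂ with a | a <;> rcases lt_or_gt_of_ne n₁₃ with b | b <;>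
    rcases lt_or_gt_of_ne n₂₃ with c | c
  · exact ⟨p₁, by simp, p₃, by simp, .inr (.inl (key h₂ h₁₂.symm h₂₃ m₂ m₁ m₃ a c))⟩
  · exact ⟨p₁, by simp, p₂, by simp, .inr (.inr (key h₃ h₁₃.symm h₂₃.symm m₃ m₁ m₂ b c))⟩
  · linarith
  · exact ⟨p₃, by simp, p₂, by simp, .inl (key h₁ h₁₃ h₁₂ m₁ m₃ m₂ b a)⟩
  · exact ⟨p₂, by simp, p₃, by simp, .inl (key h₁ h₁₂ h₁₃ m₁ m₂ m₃ a b)⟩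
  · linarith
  · exact ⟨p₂, by simp, p₁, by simp, .inr (.inr (key h₃ h₂₃.symm h₁₃.symm m₃ m₂ m₁ c b))⟩
  · exact ⟨p₃, by simp, p₁, by simp, .inr (.inl (key h₂ h₂₃ h₁₂.symm m₂ m₃ m₁ c a))⟩

namespace ExpandingMarkovMap

variable {A : Type} (M : ExpandingMarkovMap A)

/-- The derivative of the `n`-th iterate of `T`. -/
def iterDeriv (n : ℕ) (x : ℝ) : ℝ := ∏ l ∈ Finset.range n, M.T' (M.T^[l] x)

/-- The cylinder of a finite word, on which `T^[w.length]` takes values in `[0,1]`. -/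
def wordCylinder : List A → Set ℝ
  | [] => Icc 0 1
  | i :: w => M.V i ∩ M.T ⁻¹' wordCylinder w

/-- The open cylinder of a finite word, mapped onto `(0,1)` by `T^[w.length]`. -/
def openCylinder : List A → Set ℝ
  | [] => Ioo 0 1
  | i :: w => interior (M.V i) ∩ M.T ⁻¹' openCylinder w

variable {M}

theorem birkhoff_add (f : ℝ → ℝ) (m n : ℕ) (x : ℝ) :
    M.birkhoff f (m + n) x = M.birkhoff f m x + M.birkhoff f n (M.T^[m] x) := by
  simp only [birkhoff, Finset.sum_range_add]
  congr 1
  refine Finset.sum_congr rfl fun l _ => ?_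
  rw [← Function.iterate_add_apply, add_comm m l]

theorem mem_wordCylinder {w : List A} {x : ℝ} : x ∈ M.wordCylinder w ↔
    (∀ i (h : i < w.length), M.T^[i] x ∈ M.V w[i]) ∧ M.T^[w.length] x ∈ Icc (0:ℝ) 1 := by
  induction w generalizing x with
  | nil => simp [wordCylinder]
  | cons a w ih =>
    simp only [wordCylinder, mem_inter_iff, mem_preimage, ih, List.length_cons,
      Function.iterate_succ_apply]
    constructor
    · rintro ⟨h1, h2, h3⟩
      refine ⟨fun i h => ?_, h3⟩
      cases i with
      | zero => simpa using h1
      | succ i => simpa using h2 i (by simpa using h)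
    · rintro ⟨h1, h2⟩
      exact ⟨by simpa using h1 0 (by simp), fun i h => h1 (i + 1) (by simpa using h), h2⟩

theorem wordCylinder_subset_Icc (w : List A) : M.wordCylinder w ⊆ Icc 0 1 := by
  cases w with
  | nil => exact subset_rfl
  | cons a w => exact fun x hx => M.V_subset a hx.1

theorem mem_wordCylinder_append {u v : List A} {x : ℝ} :
    x ∈ M.wordCylinder (u ++ v) ↔ x ∈ M.wordCylinder u ∧ M.T^[u.length] x ∈ M.wordCylinder v := by
  induction u generalizing x with
  | nil => simpa [wordCylinder] using fun h => wordCylinder_subset_Icc v h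
  | cons a u ih =>
    simp [wordCylinder, ih, and_assoc]

theorem mem_openCylinder_append {u v : List A} {x : ℝ} :
    x ∈ M.openCylinder (u ++ v) ↔ x ∈ M.openCylinder u ∧ M.T^[u.length] x ∈ M.openCylinder v := by
  induction u generalizing x with
  | nil =>
    suffices M.openCylinder v ⊆ Ioo 0 1 by simpa [openCylinder] using fun h => this h
    cases v with
    | nil => exact subset_rfl
    | cons a v =>
      intro x hx
      simpa using interior_mono (M.V_subset a) hx.1
  | cons a u ih =>
    simp [openCylinder, ih, and_assoc]

theorem openCylinder_subset_Ioo (w : List A) : M.openCylinder w ⊆ Ioo 0 1 := fun _ hx =>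
  (mem_openCylinder_append (u := []) (v := w).1 hx).1

theorem openCylinder_subset_wordCylinder (w : List A) : M.openCylinder w ⊆ M.wordCylinder w := by
  induction w with
  | nil => exact Ioo_subset_Icc_self
  | cons a w ih => exact fun x hx => ⟨interior_subset hx.1, ih hx.2⟩

theorem disjoint_wordCylinder {u v : List A} (hl : u.length = v.length) (huv : u ≠ v) :
    Disjoint (M.wordCylinder u) (M.wordCylinder v) := by
  refine disjoint_left.2 fun x hu hv => huv (List.ext_getElem hl fun i h1 h2 => ?_)
  by_contra hne
  exact disjoint_left.1 (M.V_disjoint hne) ((mem_wordCylinder.1 hu).1 i h1)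
    ((mem_wordCylinder.1 hv).1 i h2)

theorem surjOn_openCylinder (w : List A) :
    SurjOn M.T^[w.length] (M.openCylinder w) (Ioo 0 1) := by
  induction w with
  | nil => exact surjOn_id _
  | cons a w ih =>
    intro z hz
    obtain ⟨x, hx, rfl⟩ := ih hz
    have := openCylinder_subset_Ioo w hx
    rw [← M.T_maps_interior a] at this
    obtain ⟨t, ht, rfl⟩ := this
    exact ⟨t, ⟨ht, hx⟩, rfl⟩

theorem deriv_ne_zero {i : A} {x : ℝ} (hx : x ∈ M.V i) : M.T' x ≠ 0 := by
  intro h0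
  obtain ⟨ρ, -, h⟩ := M.distortion
  have := (h 1 (fun _ => i) x x (by simpa using hx) (by simpa using hx)).1
  simp [h0] at this
  exact absurd this (not_le.2 (Real.exp_pos _))

theorem strictMonoOn_or_strictAntiOn (i : A) :
    StrictMonoOn M.T (M.V i) ∨ StrictAntiOn M.T (M.V i) :=
  (M.V_ordConnected i).strictMonoOn_or_strictAntiOn (M.T_hasDeriv i) fun _ => deriv_ne_zero

theorem ordConnected_wordCylinder (w : List A) : (M.wordCylinder w).OrdConnected := by
  induction w with
  | nil => exact ordConnected_Icc
  | cons a w ih => exact (M.V_ordConnected a).inter_preimage ih (strictMonoOn_or_strictAntiOn a)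

theorem ordConnected_openCylinder (w : List A) : (M.openCylinder w).OrdConnected := by
  induction w with
  | nil => exact ordConnected_Ioo
  | cons a w ih =>
    exact (M.V_ordConnected a).interior.inter_preimage ih
      ((strictMonoOn_or_strictAntiOn a).imp (fun h => h.mono interior_subset)
        (fun h => h.mono interior_subset))

theorem iterDeriv_succ' (n : ℕ) (x : ℝ) :
    M.iterDeriv (n + 1) x = M.iterDeriv n (M.T x) * M.T' x := by
  simp [iterDeriv, Finset.prod_range_succ']

theorem abs_iterDeriv (n : ℕ) (x : ℝ) :
    |M.iterDeriv n x| = ∏ l ∈ Finset.range n, |M.T' (M.T^[l] x)| := by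
  rw [iterDeriv, Finset.abs_prod]

theorem iterDeriv_ne_zero {w : List A} {x : ℝ} (hx : x ∈ M.wordCylinder w) :
    M.iterDeriv w.length x ≠ 0 :=
  Finset.prod_ne_zero_iff.2 fun l hl =>
    deriv_ne_zero ((mem_wordCylinder.1 hx).1 l (Finset.mem_range.1 hl))

theorem exp_birkhoff_psi {w : List A} {x : ℝ} (hx : x ∈ M.wordCylinder w) :
    Real.exp (M.birkhoff M.psi w.length x) = |M.iterDeriv w.length x| := by
  rw [abs_iterDeriv, birkhoff, Real.exp_sum]
  refine Finset.prod_congr rfl fun l hl => Real.exp_log (abs_pos.2 ?_)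
  exact deriv_ne_zero ((mem_wordCylinder.1 hx).1 l (Finset.mem_range.1 hl))

theorem hasDerivWithinAt_iterate (w : List A) : ∀ x ∈ M.wordCylinder w,
    HasDerivWithinAt M.T^[w.length] (M.iterDeriv w.length x) (M.wordCylinder w) x := by
  induction w with
  | nil => intro x _; simpa [iterDeriv] using hasDerivWithinAt_id x _
  | cons a w ih =>
    intro x hx
    have h := (ih _ hx.2).comp x ((M.T_hasDeriv a x hx.1).mono inter_subset_left)
      (fun z (hz : z ∈ M.wordCylinder (a :: w)) => hz.2)
    rw [List.length_cons, iterDeriv_succ', Function.iterate_succ]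
    exact h

/-- Mean value theorem for iterates on cylinders. -/
theorem exists_abs_iterate_sub {w : List A} {x y : ℝ} (hx : x ∈ M.wordCylinder w)
    (hy : y ∈ M.wordCylinder w) : ∃ c ∈ M.wordCylinder w,
      |M.T^[w.length] x - M.T^[w.length] y| =
        Real.exp (M.birkhoff M.psi w.length c) * |x - y| := by
  obtain ⟨c, hc, h⟩ := (ordConnected_wordCylinder w).exists_deriv_mul_sub
    (hasDerivWithinAt_iterate w) hy hx
  exact ⟨c, hc, by rw [h, abs_mul, exp_birkhoff_psi hc]⟩

theorem abs_iterate_sub_le_one {w : List A} {x y : ℝ} (hx : x ∈ M.wordCylinder w)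
    (hy : y ∈ M.wordCylinder w) : |M.T^[w.length] x - M.T^[w.length] y| ≤ 1 := by
  have h1 := (mem_wordCylinder.1 hx).2
  have h2 := (mem_wordCylinder.1 hy).2
  rw [abs_le]; constructor <;> linarith [h1.1, h1.2, h2.1, h2.2]

theorem abs_sub_le_exp_neg {w : List A} {E : ℝ}
    (hE : ∀ c ∈ M.wordCylinder w, E ≤ M.birkhoff M.psi w.length c) {x y : ℝ}
    (hx : x ∈ M.wordCylinder w) (hy : y ∈ M.wordCylinder w) :
    |x - y| ≤ Real.exp (-E) * |M.T^[w.length] x - M.T^[w.length] y| := by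
  obtain ⟨c, hc, h⟩ := exists_abs_iterate_sub hx hy
  rw [h, ← mul_assoc, ← Real.exp_add]
  exact le_mul_of_one_le_left (abs_nonneg _) (Real.one_le_exp (by linarith [hE c hc]))

/-- An interval containing an open cylinder is at least as long as the contraction along it. -/
theorem exp_neg_le_of_openCylinder_subset {w : List A} {L : ℝ}
    (hL : ∀ c ∈ M.wordCylinder w, M.birkhoff M.psi w.length c ≤ L) {a b : ℝ}
    (hab : M.openCylinder w ⊆ Icc a b) : Real.exp (-L) ≤ b - a := by
  have key : ∀ δ ∈ Ioo (0:ℝ) (1/2), 1 - 2 * δ ≤ Real.exp L * (b - a) := by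
    intro δ hδ
    obtain ⟨x, hx, hx'⟩ := surjOn_openCylinder w (show δ ∈ Ioo (0:ℝ) 1 from ⟨hδ.1, by linarith [hδ.2]⟩)
    obtain ⟨y, hy, hy'⟩ := surjOn_openCylinder w
      (show 1 - δ ∈ Ioo (0:ℝ) 1 from ⟨by linarith [hδ.2], by linarith [hδ.1]⟩)
    obtain ⟨c, hc, h⟩ := exists_abs_iterate_sub (openCylinder_subset_wordCylinder w hx)
      (openCylinder_subset_wordCylinder w hy)
    have h1 : |x - y| ≤ b - a := by
      have := hab hx; have := hab hy
      rw [abs_le]; constructor <;> linarith [(hab hx).1, (hab hx).2, (hab hy).1, (hab hy).2]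
    calc 1 - 2 * δ ≤ |M.T^[w.length] x - M.T^[w.length] y| := by
          rw [hx', hy', abs_sub_comm]; exact le_trans (by linarith) (le_abs_self _)
      _ = _ := h
      _ ≤ Real.exp L * (b - a) := by
          gcongr
          exact hL c hc
  have : (1:ℝ) ≤ Real.exp L * (b - a) := by
    by_contra! hlt
    have := key (min (1/4) ((1 - Real.exp L * (b - a)) / 4))
      ⟨lt_min (by norm_num) (by linarith), lt_of_le_of_lt (min_le_left _ _) (by norm_num)⟩
    linarith [min_le_right (1/4) ((1 - Real.exp L * (b - a)) / 4)]
  rw [Real.exp_neg, inv_le_iff_one_le_mul₀ (Real.exp_pos _)]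
  linarith

theorem openCylinder_nonempty (w : List A) : (M.openCylinder w).Nonempty := by
  obtain ⟨x, hx, -⟩ := surjOn_openCylinder w (show (1/2 : ℝ) ∈ Ioo (0:ℝ) 1 by norm_num)
  exact ⟨x, hx⟩

theorem disjoint_openCylinder {u v : List A} (hl : u.length = v.length) (huv : u ≠ v) :
    Disjoint (M.openCylinder u) (M.openCylinder v) :=
  (disjoint_wordCylinder hl huv).mono (openCylinder_subset_wordCylinder u)
    (openCylinder_subset_wordCylinder v)

theorem openCylinder_subset_of_prefix {u v : List A} (h : u <+: v) :
    M.openCylinder v ⊆ M.openCylinder u := by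
  obtain ⟨t, rfl⟩ := h
  exact fun x hx => (mem_openCylinder_append.1 hx).1

variable (M) in
/-- Some cylinder is relatively compact in `(0,1)`. -/
theorem exists_openCylinder_subset_Icc : ∃ w : List A, w ≠ [] ∧ ∃ a b : ℝ, 0 < a ∧ b < 1 ∧
    M.openCylinder w ⊆ Icc a b := by
  obtain ⟨i, j, hij⟩ := M.nontriv
  obtain ⟨p₁, h₁⟩ := M.openCylinder_nonempty [i, i]
  obtain ⟨p₂, h₂⟩ := M.openCylinder_nonempty [i, j]
  obtain ⟨p₃, h₃⟩ := M.openCylinder_nonempty [j, i]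
  have hp : ∀ p ∈ ({p₁, p₂, p₃} : Set ℝ), p ∈ Ioo (0:ℝ) 1 := by
    rintro p (rfl | rfl | rfl)
    exacts [openCylinder_subset_Ioo _ h₁, openCylinder_subset_Ioo _ h₂,
      openCylinder_subset_Ioo _ h₃]
  obtain ⟨a, ha, b, hb, h⟩ := exists_subset_Ioo_of_pairwise_disjoint
    (S₁ := M.openCylinder [i, i]) (S₂ := M.openCylinder [i, j]) (S₃ := M.openCylinder [j, i])
    (ordConnected_openCylinder _) (ordConnected_openCylinder _) (ordConnected_openCylinder _)
    (disjoint_openCylinder rfl (by simpa using hij)) (disjoint_openCylinder rfl (by simp [hij]))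
    (disjoint_openCylinder rfl (by simp [hij])) h₁ h₂ h₃
  have hw : ∃ w : List A, w ≠ [] ∧ M.openCylinder w ⊆ Ioo a b := by
    rcases h with h | h | h
    exacts [⟨_, by simp, h⟩, ⟨_, by simp, h⟩, ⟨_, by simp, h⟩]
  obtain ⟨w, hw, hs⟩ := hw
  exact ⟨w, hw, a, b, (hp a ha).1, (hp b hb).2, hs.trans Ioo_subset_Icc_self⟩

theorem closure_openCylinder_append_subset {u w : List A} {a b : ℝ} (ha : 0 < a) (hb : b < 1)
    (hw : M.openCylinder w ⊆ Icc a b) :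
    closure (M.openCylinder (u ++ w)) ⊆ M.openCylinder u := by
  have hab : a ≤ b := by
    obtain ⟨z, hz⟩ := M.openCylinder_nonempty w
    exact (hw hz).1.trans (hw hz).2
  obtain ⟨p, hp, hpa⟩ := surjOn_openCylinder (M := M) u (show a ∈ Ioo (0:ℝ) 1 from ⟨ha, by linarith⟩)
  obtain ⟨q, hq, hqb⟩ := surjOn_openCylinder (M := M) u (show b ∈ Ioo (0:ℝ) 1 from ⟨by linarith, hb⟩)
  have hsub : M.openCylinder (u ++ w) ⊆ uIcc p q := by
    intro z hz
    rw [mem_openCylinder_append] at hz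
    have h1 := hw hz.2
    have hz' := openCylinder_subset_wordCylinder u hz.1
    have hp' := openCylinder_subset_wordCylinder u hp
    have hq' := openCylinder_subset_wordCylinder u hq
    rw [← hpa, ← hqb] at h1
    rcases (ordConnected_wordCylinder u).strictMonoOn_or_strictAntiOn
      (hasDerivWithinAt_iterate u) (fun x hx => iterDeriv_ne_zero hx) with h | h
    · exact mem_uIcc.2 (.inl ⟨(h.le_iff_le hp' hz').1 h1.1, (h.le_iff_le hz' hq').1 h1.2⟩)
    · exact mem_uIcc.2 (.inr ⟨(h.le_iff_ge hz' hq').1 h1.2, (h.le_iff_ge hp' hz').1 h1.1⟩)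
  exact (closure_minimal hsub isClosed_Icc).trans
    ((ordConnected_openCylinder u).uIcc_subset hp hq)

theorem exists_forall_mem_openCylinder {w : List A} {a b : ℝ} (ha : 0 < a) (hb : b < 1)
    (hw : M.openCylinder w ⊆ Icc a b) (P : ℕ → List A) (hP : ∀ t, P t <+: P (t + 1))
    (h : ∀ t, ∃ t' u, P t <+: u ∧ P t' = u ++ w) : ∃ x, ∀ t, x ∈ M.openCylinder (P t) := by
  have hne := IsCompact.nonempty_iInter_of_sequence_nonempty_isCompact_isClosed
    (fun t => closure (M.openCylinder (P t)))
    (fun t => closure_mono (openCylinder_subset_of_prefix (hP t)))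
    (fun t => (openCylinder_nonempty _).closure)
    ((isCompact_Icc (a := (0:ℝ)) (b := 1)).of_isClosed_subset isClosed_closure
      (closure_minimal ((openCylinder_subset_Ioo _).trans Ioo_subset_Icc_self) isClosed_Icc))
    (fun t => isClosed_closure)
  obtain ⟨x, hx⟩ := hne
  refine ⟨x, fun t => ?_⟩
  obtain ⟨t', u, hu, ht'⟩ := h t
  have := mem_iInter.1 hx t'
  rw [ht'] at this
  exact openCylinder_subset_of_prefix hu (closure_openCylinder_append_subset ha hb hw this)

theorem mem_repeller_of_forall {x : ℝ}
    (h : ∀ n, ∃ w : List A, n < w.length ∧ x ∈ M.wordCylinder w) : x ∈ M.repeller := by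
  intro n
  obtain ⟨w, hn, hx⟩ := h n
  exact mem_iUnion.2 ⟨_, (mem_wordCylinder.1 hx).1 n hn⟩

theorem wordCylinder_inter_repeller_nonempty (v : List A) :
    (M.wordCylinder v ∩ M.repeller).Nonempty := by
  obtain ⟨w, hw0, a, b, ha, hb, hw⟩ := M.exists_openCylinder_subset_Icc
  have hsucc : ∀ t, v ++ (List.replicate (t + 1) w).flatten =
      (v ++ (List.replicate t w).flatten) ++ w := by
    intro t
    simp [List.replicate_succ', List.flatten_append]
  obtain ⟨x, hx⟩ := exists_forall_mem_openCylinder ha hb hw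
    (fun t => v ++ (List.replicate t w).flatten)
    (fun t => ⟨w, (hsucc t).symm⟩) (fun t => ⟨t + 1, _, List.prefix_rfl, hsucc t⟩)
  have hx' := fun t => openCylinder_subset_wordCylinder _ (hx t)
  refine ⟨x, by simpa using hx' 0, mem_repeller_of_forall fun n => ⟨_, ?_, hx' (n + 1)⟩⟩
  have : 1 ≤ w.length := List.length_pos_iff.2 hw0
  simp only [List.length_append, List.length_flatten, List.map_replicate, List.sum_replicate,
    smul_eq_mul]
  nlinarith

theorem iterate_mem_repeller {x : ℝ} (hx : x ∈ M.repeller) (n : ℕ) : M.T^[n] x ∈ M.repeller := by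
  intro m
  rw [← Function.iterate_add_apply]
  exact hx _

theorem mem_Icc_of_mem_repeller {x : ℝ} (hx : x ∈ M.repeller) : x ∈ Icc (0:ℝ) 1 := by
  obtain ⟨i, hi⟩ := mem_iUnion.1 (hx 0)
  exact M.V_subset i hi

theorem mem_wordCylinder_ofFn {n : ℕ} {ω : Fin n → A} {x : ℝ} (hx : x ∈ M.repeller) :
    x ∈ M.wordCylinder (List.ofFn ω) ↔ x ∈ M.cylinder ω := by
  rw [mem_wordCylinder]
  constructor
  · rintro ⟨h, -⟩ ν
    simpa using h ν (by simp)
  · intro h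
    refine ⟨fun i hi => ?_, mem_Icc_of_mem_repeller (iterate_mem_repeller hx _)⟩
    simpa using h ⟨i, by simpa using hi⟩

theorem mem_cylinder_of_mem_wordCylinder {w : List A} {x : ℝ} (hx : x ∈ M.wordCylinder w) :
    x ∈ M.cylinder (fun i : Fin w.length => w[i]) :=
  fun ν => (mem_wordCylinder.1 hx).1 ν ν.2

variable (M) in
theorem exists_mul_length_le_birkhoff_psi : ∃ c > 0, ∃ N : ℕ, ∀ w : List A, N ≤ w.length →
    ∀ x ∈ M.wordCylinder w, c * w.length ≤ M.birkhoff M.psi w.length x := by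
  obtain ⟨ξ, hξ, N, h⟩ := M.expanding
  refine ⟨Real.log ξ, Real.log_pos hξ, N, fun w hw x hx => ?_⟩
  have := h w.length hw _ x (mem_cylinder_of_mem_wordCylinder hx)
  rw [← abs_iterDeriv, ← exp_birkhoff_psi hx] at this
  rw [← Real.exp_le_exp, mul_comm, Real.exp_nat_mul, Real.exp_log (by linarith)]
  exact this.le

variable (M) in
theorem exists_distortion_psi : ∃ ρ : ℕ → ℝ, Tendsto ρ atTop (𝓝 0) ∧ ∀ w : List A,
    ∀ x ∈ M.wordCylinder w, ∀ y ∈ M.wordCylinder w,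
      M.birkhoff M.psi w.length x ≤ M.birkhoff M.psi w.length y + w.length * ρ w.length := by
  obtain ⟨ρ, hρ, h⟩ := M.distortion
  refine ⟨ρ, hρ, fun w x hx y hy => ?_⟩
  have := (h w.length _ x y (mem_cylinder_of_mem_wordCylinder hx)
    (mem_cylinder_of_mem_wordCylinder hy)).2
  rw [← abs_iterDeriv, ← abs_iterDeriv, ← exp_birkhoff_psi hx, ← exp_birkhoff_psi hy,
    ← Real.exp_sub, Real.exp_le_exp] at this
  linarith

theorem Tempered.exists_abs_birkhoff_sub_le {φ : ℝ → ℝ} (hφ : M.Tempered φ) : ∃ C, ∀ n,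
    ∀ ω : Fin n → A, ∀ x ∈ M.cylinder ω ∩ M.repeller, ∀ y ∈ M.cylinder ω ∩ M.repeller,
      |M.birkhoff φ n x - M.birkhoff φ n y| ≤ n * C := by
  obtain ⟨C, hC⟩ := hφ.1
  refine ⟨C, fun n ω x hx y hy => ?_⟩
  rw [birkhoff, birkhoff, ← Finset.sum_sub_distrib]
  refine (Finset.abs_sum_le_sum_abs _ _).trans ?_
  have : ∀ l ∈ Finset.range n, |φ (M.T^[l] x) - φ (M.T^[l] y)| ≤ C := by
    intro l hl
    have hl' := Finset.mem_range.1 hl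
    exact hC ⟨fun _ => ω ⟨l, hl'⟩, M.T^[l] x,
      ⟨fun ν => by simpa using hx.1 ⟨l, hl'⟩, iterate_mem_repeller hx.2 l⟩, M.T^[l] y,
      ⟨fun ν => by simpa using hy.1 ⟨l, hl'⟩, iterate_mem_repeller hy.2 l⟩, rfl⟩
  simpa using Finset.sum_le_sum this

theorem Tempered.exists_distortion {φ : ℝ → ℝ} (hφ : M.Tempered φ) : ∃ ρ : ℕ → ℝ,
    Tendsto ρ atTop (𝓝 0) ∧ ∀ w : List A, ∀ x ∈ M.wordCylinder w ∩ M.repeller,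
      ∀ y ∈ M.wordCylinder w ∩ M.repeller,
        M.birkhoff φ w.length x ≤ M.birkhoff φ w.length y + w.length * ρ w.length := by
  obtain ⟨C, hC⟩ := hφ.exists_abs_birkhoff_sub_le
  refine ⟨_, hφ.2, fun w x hx y hy => ?_⟩
  rcases Nat.eq_zero_or_pos w.length with h0 | h0
  · simp [h0, birkhoff]
  have hbdd : BddAbove (M.varSet (M.birkhoff φ w.length) w.length) := by
    refine ⟨w.length * C, ?_⟩
    rintro d ⟨ω, x, hx, y, hy, rfl⟩
    exact hC _ ω x hx y hy
  have := le_csSup hbdd ⟨_, x, ⟨mem_cylinder_of_mem_wordCylinder hx.1, hx.2⟩, y,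
    ⟨mem_cylinder_of_mem_wordCylinder hy.1, hy.2⟩, rfl⟩
  rw [mul_div_cancel₀ _ (by positivity)]
  have h2 := (le_abs_self _).trans this
  rw [var]
  linarith

/-- Tempered distortion of `ψ` and `φ` with a common nonnegative error term. -/
theorem Tempered.exists_common_distortion {φ : ℝ → ℝ} (hφ : M.Tempered φ) : ∃ ε : ℕ → ℝ,
    Tendsto ε atTop (𝓝 0) ∧ (∀ n, 0 ≤ ε n) ∧
    (∀ w : List A, ∀ x ∈ M.wordCylinder w, ∀ y ∈ M.wordCylinder w,
      M.birkhoff M.psi w.length x ≤ M.birkhoff M.psi w.length y + w.length * ε w.length) ∧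
    ∀ w : List A, ∀ x ∈ M.wordCylinder w ∩ M.repeller, ∀ y ∈ M.wordCylinder w ∩ M.repeller,
        M.birkhoff φ w.length x ≤ M.birkhoff φ w.length y + w.length * ε w.length := by
  obtain ⟨ρ₁, h₁, h₁'⟩ := M.exists_distortion_psi
  obtain ⟨ρ₂, h₂, h₂'⟩ := hφ.exists_distortion
  refine ⟨fun n => |ρ₁ n| + |ρ₂ n|, by simpa using h₁.abs.add h₂.abs, fun n => by positivity,
    fun w x hx y hy => (h₁' w x hx y hy).trans ?_, fun w x hx y hy => (h₂' w x hx y hy).trans ?_⟩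
  · gcongr
    linarith [le_abs_self (ρ₁ w.length), abs_nonneg (ρ₂ w.length)]
  · gcongr
    linarith [le_abs_self (ρ₂ w.length), abs_nonneg (ρ₁ w.length)]

theorem Tempered.exists_birkhoff_le {φ : ℝ → ℝ} (hφ : M.Tempered φ) (w : List A) :
    ∃ C, ∀ x ∈ M.wordCylinder w ∩ M.repeller, M.birkhoff φ w.length x ≤ C := by
  obtain ⟨ε, -, -, -, h⟩ := hφ.exists_common_distortion
  obtain ⟨y, hy⟩ := M.wordCylinder_inter_repeller_nonempty w
  exact ⟨_, fun x hx => h w x hx y hy⟩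

variable (M) in
theorem exists_birkhoff_psi_le (w : List A) :
    ∃ C, ∀ x ∈ M.wordCylinder w, M.birkhoff M.psi w.length x ≤ C := by
  obtain ⟨ρ, -, h⟩ := M.exists_distortion_psi
  obtain ⟨y, hy⟩ := M.wordCylinder_inter_repeller_nonempty w
  exact ⟨_, fun x hx => h w x hx y hy.1⟩

variable (M) in
/-- The `n`-th partition function `∑_{ω ∈ Aⁿ} exp S_n(f)(ω)` of a potential. -/
noncomputable def partitionSum (f : ℝ → ℝ) (n : ℕ) : ENNReal :=
  ∑' ω : Fin n → A, ENNReal.ofReal (Real.exp (M.birkhoffSup f ω))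

theorem one_div_mul_log_le_iff {n : ℕ} (hn : 0 < n) {Z : ENNReal} {c : ℝ} :
    ((1 / (n : ℝ) : ℝ) : EReal) * ENNReal.log Z ≤ c ↔ Z ≤ ENNReal.ofReal (Real.exp (n * c)) := by
  have hn' : (0:ℝ) < n := by exact_mod_cast hn
  have h1 : Z ≤ ENNReal.ofReal (Real.exp (n * c)) ↔ ENNReal.log Z ≤ ((n * c : ℝ) : EReal) := by
    rw [← EReal.exp_coe, ← EReal.log_exp ((n * c : ℝ) : EReal), ENNReal.log_le_log_iff,
      EReal.log_exp]
  rw [h1]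
  generalize ENNReal.log Z = L
  induction L with
  | bot =>
    rw [EReal.coe_mul_bot_of_pos (by positivity)]
    simp
  | coe r =>
    rw [← EReal.coe_mul, EReal.coe_le_coe_iff, EReal.coe_le_coe_iff, one_div,
      inv_mul_le_iff₀ hn']
  | top =>
    rw [EReal.coe_mul_top_of_pos (by positivity)]
    simp only [top_le_iff, EReal.coe_ne_top]

theorem pressure_nonpos_iff {f : ℝ → ℝ} : M.pressure f ≤ 0 ↔ ∀ δ > 0, ∀ᶠ n : ℕ in atTop,
    M.partitionSum f n ≤ ENNReal.ofReal (Real.exp (n * δ)) := by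
  constructor
  · intro h δ hδ
    have h' : M.pressure f < (δ : EReal) := h.trans_lt (by exact_mod_cast hδ)
    filter_upwards [eventually_lt_of_limsup_lt h', eventually_gt_atTop 0] with n hn hn0
    exact (one_div_mul_log_le_iff hn0).1 hn.le
  · intro h
    refine EReal.le_of_forall_lt_iff_le.1 fun δ hδ => ?_
    refine limsup_le_of_le (by isBoundedDefault) ?_
    filter_upwards [h δ (by exact_mod_cast hδ), eventually_gt_atTop 0] with n hn hn0
    exact (one_div_mul_log_le_iff hn0).2 hn

theorem birkhoff_neg_mul (s : ℝ) (φ : ℝ → ℝ) (n : ℕ) (x : ℝ) :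
    M.birkhoff (fun x => -s * (M.psi x + φ x)) n x =
      -s * (M.birkhoff M.psi n x + M.birkhoff φ n x) := by
  simp only [birkhoff, ← Finset.mul_sum, Finset.sum_add_distrib]

theorem birkhoff_nonneg {φ : ℝ → ℝ} (hφ0 : ∀ x ∈ M.repeller, 0 ≤ φ x) (n : ℕ) {x : ℝ}
    (hx : x ∈ M.repeller) : 0 ≤ M.birkhoff φ n x :=
  Finset.sum_nonneg fun l _ => hφ0 _ (iterate_mem_repeller hx l)

/-- The supremum of the Birkhoff sums of `-s(ψ+φ)` over a cylinder is comparable with any of their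
values. -/
theorem Tempered.exists_birkhoffSup_bounds {φ : ℝ → ℝ} (hφ : M.Tempered φ) : ∃ ε : ℕ → ℝ,
    Tendsto ε atTop (𝓝 0) ∧ (∀ n, 0 ≤ ε n) ∧
    (∀ w : List A, ∀ x ∈ M.wordCylinder w, ∀ y ∈ M.wordCylinder w,
      M.birkhoff M.psi w.length x ≤ M.birkhoff M.psi w.length y + w.length * ε w.length) ∧
    (∀ w : List A, ∀ x ∈ M.wordCylinder w ∩ M.repeller, ∀ y ∈ M.wordCylinder w ∩ M.repeller,
        M.birkhoff φ w.length x ≤ M.birkhoff φ w.length y + w.length * ε w.length) ∧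
    ∀ (s : ℝ) (n : ℕ) (ω : Fin n → A), ∀ x ∈ M.wordCylinder (List.ofFn ω) ∩ M.repeller,
      -s * (M.birkhoff M.psi n x + M.birkhoff φ n x) ≤
        M.birkhoffSup (fun x => -s * (M.psi x + φ x)) ω ∧
      M.birkhoffSup (fun x => -s * (M.psi x + φ x)) ω ≤
        -s * (M.birkhoff M.psi n x + M.birkhoff φ n x) + |s| * (2 * (n * ε n)) := by
  obtain ⟨ε, h1, h2, h3, h4⟩ := hφ.exists_common_distortion
  refine ⟨ε, h1, h2, h3, h4, fun s n ω x hx => ?_⟩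
  have hx' := hx
  rw [mem_inter_iff, mem_wordCylinder_ofFn hx.2] at hx'
  have hub : ∀ v ∈ {v | ∃ x ∈ M.cylinder ω ∩ M.repeller,
      v = M.birkhoff (fun x => -s * (M.psi x + φ x)) n x},
      v ≤ -s * (M.birkhoff M.psi n x + M.birkhoff φ n x) + |s| * (2 * (n * ε n)) := by
    rintro v ⟨z, hz, rfl⟩
    have hz' := (mem_wordCylinder_ofFn hz.2).2 hz.1
    rw [birkhoff_neg_mul]
    have a1 := h3 _ x hx.1 z hz'
    have a2 := h3 _ z hz' x hx.1
    have a3 := h4 _ x hx z ⟨hz', hz.2⟩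
    have a4 := h4 _ z ⟨hz', hz.2⟩ x hx
    rw [List.length_ofFn] at a1 a2 a3 a4
    have : |M.birkhoff M.psi n x + M.birkhoff φ n x - (M.birkhoff M.psi n z + M.birkhoff φ n z)|
        ≤ 2 * (n * ε n) := abs_le.2 ⟨by linarith, by linarith⟩
    have h5 := (le_abs_self _).trans ((abs_mul s _).le.trans
      (mul_le_mul_of_nonneg_left this (abs_nonneg s)))
    linarith
  constructor
  · exact le_csSup ⟨_, hub⟩ ⟨x, hx', (birkhoff_neg_mul s φ n x).symm⟩
  · exact csSup_le ⟨_, x, hx', rfl⟩ hub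

theorem nonneg_of_pressure_nonpos {φ : ℝ → ℝ} (hφ0 : ∀ x ∈ M.repeller, 0 ≤ φ x)
    (hφ : M.Tempered φ) {s : ℝ} (hs : M.pressure (fun x => -s * (M.psi x + φ x)) ≤ 0) :
    0 ≤ s := by
  by_contra! hs0
  obtain ⟨c, hc, N, hN⟩ := M.exists_mul_length_le_birkhoff_psi
  obtain ⟨i, -, -⟩ := M.nontriv
  obtain ⟨ε, -, -, -, -, h5⟩ := hφ.exists_birkhoffSup_bounds
  have := pressure_nonpos_iff.1 hs (-s * c / 2) (by nlinarith)
  obtain ⟨n, hn1, hn2, hn3⟩ :=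
    (this.and ((eventually_ge_atTop N).and (eventually_gt_atTop 0))).exists
  obtain ⟨x, hx⟩ := M.wordCylinder_inter_repeller_nonempty (List.ofFn fun _ : Fin n => i)
  have h6 := (ENNReal.le_tsum (fun _ : Fin n => i)).trans hn1
  rw [ENNReal.ofReal_le_ofReal_iff (Real.exp_pos _).le, Real.exp_le_exp] at h6
  have h7 := (h5 s n _ x hx).1
  have h8 := hN _ (by simpa using hn2) x hx.1
  rw [List.length_ofFn] at h8
  have h9 := birkhoff_nonneg hφ0 n hx.2
  have hn' : (0:ℝ) < n := by exact_mod_cast hn3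
  have h10 : -s * (c * n) ≤ -s * (M.birkhoff M.psi n x + M.birkhoff φ n x) :=
    mul_le_mul_of_nonneg_left (by linarith) (by linarith)
  have : 0 < -s * c * n := by have := neg_pos.2 hs0; positivity
  linarith

theorem ofReal_exp_neg_le_volume {w : List A} {L : ℝ}
    (hL : ∀ c ∈ M.wordCylinder w, M.birkhoff M.psi w.length c ≤ L) :
    ENNReal.ofReal (Real.exp (-L)) ≤ MeasureTheory.volume (M.wordCylinder w) := by
  have hb : BddBelow (M.wordCylinder w) := bddBelow_Icc.mono (wordCylinder_subset_Icc w)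
  have ha : BddAbove (M.wordCylinder w) := bddAbove_Icc.mono (wordCylinder_subset_Icc w)
  have := exp_neg_le_of_openCylinder_subset hL (a := sInf (M.wordCylinder w))
    (b := sSup (M.wordCylinder w)) fun x hx =>
      ⟨csInf_le hb (openCylinder_subset_wordCylinder w hx),
        le_csSup ha (openCylinder_subset_wordCylinder w hx)⟩
  refine (ENNReal.ofReal_le_ofReal this).trans ?_
  rw [← Real.volume_Ioo]
  exact MeasureTheory.measure_mono
    (IsConnected.Ioo_csInf_csSup_subset ⟨(M.wordCylinder_inter_repeller_nonempty w).mono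
      inter_subset_left, (ordConnected_wordCylinder w).isPreconnected⟩ hb ha)

theorem pressure_neg_nonpos {φ : ℝ → ℝ} (hφ0 : ∀ x ∈ M.repeller, 0 ≤ φ x)
    (hφ : M.Tempered φ) : M.pressure (fun x => -1 * (M.psi x + φ x)) ≤ 0 := by
  have := M.countable
  obtain ⟨ε, h1, h2, h3, h4, h5⟩ := hφ.exists_birkhoffSup_bounds
  refine pressure_nonpos_iff.2 fun δ hδ => ?_
  filter_upwards [h1.eventually_lt_const (show 0 < δ / 3 by positivity)] with n hn
  have hterm : ∀ ω : Fin n → A,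
      ENNReal.ofReal (Real.exp (M.birkhoffSup (fun x => -1 * (M.psi x + φ x)) ω)) ≤
        ENNReal.ofReal (Real.exp (n * δ)) *
          MeasureTheory.volume (M.wordCylinder (List.ofFn ω)) := by
    intro ω
    obtain ⟨x, hx⟩ := M.wordCylinder_inter_repeller_nonempty (List.ofFn ω)
    have hv := ofReal_exp_neg_le_volume fun c hc => h3 _ c hc x hx.1
    refine le_trans ?_ (mul_le_mul_right hv _)
    rw [← ENNReal.ofReal_mul (Real.exp_pos _).le, ← Real.exp_add]
    refine ENNReal.ofReal_le_ofReal (Real.exp_le_exp.2 ?_)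
    have h6 := (h5 1 n ω x hx).2
    have h7 := birkhoff_nonneg hφ0 n hx.2
    have h8 : (n:ℝ) * ε n ≤ n * (δ / 3) := by gcongr
    simp only [List.length_ofFn, abs_one] at h6 ⊢
    linarith
  refine (ENNReal.tsum_le_tsum hterm).trans ?_
  rw [ENNReal.tsum_mul_left, ← MeasureTheory.measure_iUnion]
  · refine mul_le_of_le_one_right' ?_
    refine (MeasureTheory.measure_mono (iUnion_subset fun ω => wordCylinder_subset_Icc _)).trans ?_
    simp
  · intro ω ω' h
    exact disjoint_wordCylinder (by simp) (fun e => h (List.ofFn_injective e))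
  · exact fun ω => (ordConnected_wordCylinder _).measurableSet

theorem dimH_shrinkingTarget_le {φ : ℝ → ℝ} (hφ0 : ∀ x ∈ M.repeller, 0 ≤ φ x)
    (hφ : M.Tempered φ) (y : ℝ) {s t : ℝ}
    (hs : M.pressure (fun x => -s * (M.psi x + φ x)) ≤ 0) (hst : s < t) :
    dimH (M.shrinkingTarget y φ) ≤ ENNReal.ofReal t := by
  have := M.countable
  have hs0 := nonneg_of_pressure_nonpos hφ0 hφ hs
  have ht0 : 0 < t := hs0.trans_lt hst
  obtain ⟨c, hc, N, hN⟩ := M.exists_mul_length_le_birkhoff_psi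
  obtain ⟨ε, h1, h2, h3, h4, h5⟩ := hφ.exists_birkhoffSup_bounds
  have hq : 0 < (t - s) * c / 4 := by have := sub_pos.2 hst; positivity
  set U : ∀ n : ℕ, (Fin n → A) → Set ℝ := fun n ω =>
    {x | x ∈ M.wordCylinder (List.ofFn ω) ∩ M.repeller ∧
      |M.T^[n] x - y| < Real.exp (-(M.birkhoff φ n x))} with hU
  have hdiam : ∀ n, ∀ ω : Fin n → A, ∀ x ∈ U n ω, Metric.ediam (U n ω) ≤ ENNReal.ofReal
      (2 * Real.exp (-(M.birkhoff M.psi n x + M.birkhoff φ n x) + 2 * (n * ε n))) := by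
    intro n ω x hx
    have key : ∀ z ∈ U n ω, M.birkhoff φ n x ≤ M.birkhoff φ n z + n * ε n := by
      intro z hz
      simpa using h4 _ x hx.1 z hz.1
    refine Metric.ediam_le fun z hz z' hz' => ?_
    rw [edist_dist, Real.dist_eq]
    refine ENNReal.ofReal_le_ofReal ?_
    have hb := abs_sub_le_exp_neg (fun c hc => sub_le_iff_le_add.2 (h3 _ x hx.1.1 c hc))
      hz.1.1 hz'.1.1
    rw [List.length_ofFn] at hb
    have hT : |M.T^[n] z - M.T^[n] z'| ≤ 2 * Real.exp (-(M.birkhoff φ n x) + n * ε n) := by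
      have e1 : Real.exp (-(M.birkhoff φ n z)) ≤ Real.exp (-(M.birkhoff φ n x) + n * ε n) :=
        Real.exp_le_exp.2 (by linarith [key z hz])
      have e2 : Real.exp (-(M.birkhoff φ n z')) ≤ Real.exp (-(M.birkhoff φ n x) + n * ε n) :=
        Real.exp_le_exp.2 (by linarith [key z' hz'])
      have e3 := abs_sub_le (M.T^[n] z) y (M.T^[n] z')
      rw [abs_sub_comm y] at e3
      linarith [hz.2, hz'.2]
    refine hb.trans ((mul_le_mul_of_nonneg_left hT (Real.exp_pos _).le).trans_eq ?_)
    rw [mul_left_comm, ← Real.exp_add]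
    ring_nf
  have hlow : ∀ n, N ≤ n → ∀ ω : Fin n → A, ∀ x ∈ U n ω,
      c * n ≤ M.birkhoff M.psi n x + M.birkhoff φ n x := by
    intro n hn ω x hx
    have := hN _ (by simpa using hn) x hx.1.1
    rw [List.length_ofFn] at this
    linarith [birkhoff_nonneg hφ0 n hx.1.2]
  obtain ⟨N', hN'⟩ := eventually_atTop.1 ((eventually_ge_atTop N).and
    ((h1.eventually_lt_const (show 0 < c / 4 by positivity)).and
    ((h1.eventually_lt_const (show 0 < (t - s) * c / 4 / (2 * t) by positivity)).and
    (pressure_nonpos_iff.1 hs ((t - s) * c / 4) hq))))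
  have hsum : ∀ n, N' ≤ n → ∑' ω : Fin n → A, Metric.ediam (U n ω) ^ t ≤
      ENNReal.ofReal (2 ^ t * Real.exp (n * -((t - s) * c / 4))) := by
    intro n hn
    obtain ⟨a1, -, a3, a4⟩ := hN' n hn
    have hterm : ∀ ω : Fin n → A, Metric.ediam (U n ω) ^ t ≤
        ENNReal.ofReal (2 ^ t * Real.exp (n * -(3 * ((t - s) * c / 4)))) *
          ENNReal.ofReal (Real.exp (M.birkhoffSup (fun x => -s * (M.psi x + φ x)) ω)) := by
      intro ω
      rcases (U n ω).eq_empty_or_nonempty with h | ⟨x, hx⟩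
      · simp [h, ht0]
      refine (ENNReal.rpow_le_rpow (hdiam n ω x hx) ht0.le).trans ?_
      rw [ENNReal.ofReal_rpow_of_pos (by positivity), ← ENNReal.ofReal_mul (by positivity),
        Real.mul_rpow (by norm_num) (Real.exp_pos _).le, ← Real.exp_mul, mul_assoc, ← Real.exp_add]
      refine ENNReal.ofReal_le_ofReal (mul_le_mul_of_nonneg_left (Real.exp_le_exp.2 ?_)
        (by positivity))
      have b1 := (h5 s n ω x hx.1).1
      have b2 := mul_le_mul_of_nonneg_left (hlow n a1 ω x hx) (sub_pos.2 hst).le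
      have b3 : n * (ε n * (2 * t)) ≤ n * ((t - s) * c / 4) := by
        gcongr
        exact ((lt_div_iff₀ (by positivity)).1 a3).le
      linarith
    refine (ENNReal.tsum_le_tsum hterm).trans ?_
    rw [ENNReal.tsum_mul_left]
    refine (mul_le_mul_right a4 _).trans ?_
    rw [← ENNReal.ofReal_mul (by positivity), mul_assoc, ← Real.exp_add]
    refine ENNReal.ofReal_le_ofReal (mul_le_mul_of_nonneg_left (Real.exp_le_exp.2 ?_)
        (by positivity))
    have : 0 ≤ n * ((t - s) * c / 4) := by positivity
    linarith
  have hsmall : ∀ n, N' ≤ n → ∀ ω : Fin n → A, Metric.ediam (U n ω) ≤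
      ENNReal.ofReal (2 * Real.exp (-(c / 2) * n)) := by
    intro n hn ω
    obtain ⟨a1, a2, -, -⟩ := hN' n hn
    rcases (U n ω).eq_empty_or_nonempty with h | ⟨x, hx⟩
    · simp [h]
    refine (hdiam n ω x hx).trans (ENNReal.ofReal_le_ofReal
      (mul_le_mul_of_nonneg_left (Real.exp_le_exp.2 ?_) (by norm_num)))
    have b2 := hlow n a1 ω x hx
    have b3 : (n : ℝ) * ε n ≤ n * (c / 4) := by gcongr
    linarith
  have hfin : ∑' k : ℕ, ENNReal.ofReal (2 ^ t * Real.exp (k * -((t - s) * c / 4))) ≠ ⊤ :=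
    ((Real.summable_exp_nat_mul_iff.2 (neg_lt_zero.2 hq)).mul_left _).tsum_ofReal_ne_top
  have hr : Tendsto (fun m : ℕ => ENNReal.ofReal (2 * Real.exp (-(c / 2) * m))) atTop (𝓝 0) := by
    rw [← ENNReal.ofReal_zero]
    refine ENNReal.tendsto_ofReal ?_
    have : Tendsto (fun m : ℕ => -(c / 2) * (m : ℝ)) atTop atBot :=
      tendsto_natCast_atTop_atTop.const_mul_atTop_of_neg (by linarith)
    simpa using (Real.tendsto_exp_atBot.comp this).const_mul 2
  have hH := MeasureTheory.Measure.hausdorffMeasure_le_liminf_tsum (ι := fun m : ℕ =>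
    Σ k : ℕ, (Fin (m + k) → A)) t (M.shrinkingTarget y φ) _ hr
    (fun m i => U (m + i.1) i.2) (eventually_atTop.2 ⟨N', fun m hm i =>
      (hsmall _ (by omega) i.2).trans (ENNReal.ofReal_le_ofReal
        (mul_le_mul_of_nonneg_left (Real.exp_le_exp.2 (by
          push_cast
          have : 0 ≤ c / 2 * (i.1 : ℝ) := by positivity
          linarith)) (by norm_num)))⟩)
    (Eventually.of_forall fun m x hx => by
      obtain ⟨n, hn⟩ := mem_iUnion.1 (mem_iInter.1 hx m)
      obtain ⟨hmn, hxr, hxn⟩ := mem_iUnion.1 hn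
      obtain ⟨k, rfl⟩ := Nat.exists_eq_add_of_le hmn
      choose ω hω using fun l : ℕ => mem_iUnion.1 (hxr l)
      exact mem_iUnion.2 ⟨⟨k, fun ν => ω ν⟩,
        ⟨(mem_wordCylinder_ofFn hxr).2 fun ν => hω ν, hxr⟩, hxn⟩)
  have hne : MeasureTheory.Measure.hausdorffMeasure t (M.shrinkingTarget y φ) ≠ ⊤ := by
    refine ne_top_of_le_ne_top hfin (hH.trans ?_)
    refine (liminf_le_liminf (v := fun _ : ℕ => ∑' k : ℕ,
      ENNReal.ofReal (2 ^ t * Real.exp (k * -((t - s) * c / 4)))) (eventually_atTop.2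
        ⟨N', fun m hm => ?_⟩)).trans_eq (liminf_const _)
    rw [ENNReal.tsum_sigma (fun k (ω : Fin (m + k) → A) => Metric.ediam (U (m + k) ω) ^ t)]
    refine ENNReal.tsum_le_tsum fun k => (hsum _ (by omega)).trans (ENNReal.ofReal_le_ofReal
        (mul_le_mul_of_nonneg_left (Real.exp_le_exp.2 ?_) (by positivity)))
    push_cast
    have : 0 ≤ (m:ℝ) * ((t - s) * c / 4) := by positivity
    linarith
  rw [← Real.coe_toNNReal t ht0.le] at hne
  exact dimH_le_of_hausdorffMeasure_ne_top hne

end ExpandingMarkovMap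

/-- If every level set of `i ↦ (⌊u i⌋, ⌊v i⌋)` grows at most with rate `s`, then the series of
`exp (-t (u i + v i))` with `s < t` is bounded by a constant depending only on `s` and `t`. -/
theorem exists_tsum_exp_neg_le {s t : ℝ} (hst : s < t) (ht : 0 ≤ t) : ∃ G : ℝ, 0 ≤ G ∧
    ∀ {ι : Type} (u v : ι → ℝ), (∀ i, 0 ≤ u i) → (∀ i, 0 ≤ v i) →
      (∀ (a b : ℕ) (F : Finset ι), (∀ i ∈ F, ⌊u i⌋₊ = a ∧ ⌊v i⌋₊ = b) →
        (F.card : ℝ) ≤ Real.exp (s * ((a + 1) + (b + 1)))) →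
      ∑' i, ENNReal.ofReal (Real.exp (-t * (u i + v i))) ≤ ENNReal.ofReal G := by
  classical
  set q := Real.exp (s - t) with hq
  have hq0 : 0 ≤ q := (Real.exp_pos _).le
  have hq1 : q < 1 := Real.exp_lt_one_iff.2 (by linarith)
  have hsum : Summable fun p : ℕ × ℕ => q ^ p.1 * q ^ p.2 :=
    (summable_geometric_of_lt_one hq0 hq1).mul_of_nonneg (summable_geometric_of_lt_one hq0 hq1)
      (fun _ => pow_nonneg hq0 _) (fun _ => pow_nonneg hq0 _)
  refine ⟨Real.exp (s * 2) * ∑' p : ℕ × ℕ, q ^ p.1 * q ^ p.2,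
    mul_nonneg (Real.exp_pos _).le (tsum_nonneg fun p => by positivity), ?_⟩
  intro ι u v hu hv hcard
  rw [ENNReal.tsum_eq_iSup_sum]
  refine iSup_le fun F => ?_
  rw [← ENNReal.ofReal_sum_of_nonneg fun _ _ => (Real.exp_pos _).le]
  refine ENNReal.ofReal_le_ofReal ?_
  set g : ι → ℕ × ℕ := fun i => (⌊u i⌋₊, ⌊v i⌋₊)
  calc ∑ i ∈ F, Real.exp (-t * (u i + v i))
      ≤ ∑ i ∈ F, (fun p : ℕ × ℕ => Real.exp (-t * (p.1 + p.2))) (g i) := by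
        refine Finset.sum_le_sum fun i _ => Real.exp_le_exp.2 ?_
        have := Nat.floor_le (hu i)
        have := Nat.floor_le (hv i)
        simp only [g]
        nlinarith
    _ = ∑ p ∈ F.image g, (F.filter fun i => g i = p).card • Real.exp (-t * (p.1 + p.2)) :=
        Finset.sum_comp (fun p : ℕ × ℕ => Real.exp (-t * (p.1 + p.2))) g
    _ ≤ ∑ p ∈ F.image g, Real.exp (s * 2) * (q ^ p.1 * q ^ p.2) := by
        refine Finset.sum_le_sum fun p _ => ?_
        have h1 := hcard p.1 p.2 (F.filter fun i => g i = p) fun i hi => by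
          have := (Finset.mem_filter.1 hi).2
          exact ⟨congrArg Prod.fst this, congrArg Prod.snd this⟩
        rw [nsmul_eq_mul]
        refine (mul_le_mul_of_nonneg_right h1 (Real.exp_pos _).le).trans_eq ?_
        rw [hq, ← Real.exp_nat_mul, ← Real.exp_nat_mul, ← Real.exp_add, ← Real.exp_add,
          ← Real.exp_add]
        congr 1
        ring
    _ ≤ _ := by
        rw [← Finset.mul_sum]
        exact mul_le_mul_of_nonneg_left (hsum.sum_le_tsum _ fun p _ => by positivity)
          (Real.exp_pos _).le

namespace ExpandingMarkovMap

variable {A : Type} {M : ExpandingMarkovMap A}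

/-- If `P(-t(ψ+φ)) > 0` and `s < t`, then there are many words of the same length on which
`ψ` and `φ` have essentially the same Birkhoff sums. -/
theorem exists_injective_blocks {φ : ℝ → ℝ} (hφ0 : ∀ x ∈ M.repeller, 0 ≤ φ x)
    (hφ : M.Tempered φ) {s t : ℝ} (ht : 0 < t) (hst : s < t)
    (hP : ¬ M.pressure (fun x => -t * (M.psi x + φ x)) ≤ 0) :
    ∃ (n b : ℕ) (lam kap : ℝ) (B : Fin b → List A), 0 < n ∧ 0 < lam ∧ 0 < kap ∧
      Function.Injective B ∧ (∀ i, (B i).length = n) ∧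
      (∀ i, ∀ x ∈ M.wordCylinder (B i), M.birkhoff M.psi n x ≤ lam) ∧
      (∀ i, ∀ x ∈ M.wordCylinder (B i) ∩ M.repeller, M.birkhoff φ n x ≤ kap) ∧
      Real.exp (s * (lam + kap)) ≤ b := by
  obtain ⟨ε, h1, h2, h3, h4, h5⟩ := hφ.exists_birkhoffSup_bounds
  obtain ⟨c, hc, N, hN⟩ := M.exists_mul_length_le_birkhoff_psi
  obtain ⟨G, hG0, hG⟩ := exists_tsum_exp_neg_le hst ht.le
  rw [pressure_nonpos_iff] at hP
  push Not at hP
  obtain ⟨δ, hδ, hP⟩ := hP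
  have hexp : Tendsto (fun n : ℕ => Real.exp (n * (δ / 2))) atTop atTop :=
    Real.tendsto_exp_atTop.comp (tendsto_natCast_atTop_atTop.atTop_mul_const (by positivity))
  obtain ⟨n, hPn, hn0, hnN, hnε, hnG⟩ := (hP.and_eventually ((eventually_gt_atTop 0).and
    ((eventually_ge_atTop N).and ((h1.eventually_lt_const (show 0 < δ / (8 * t) by positivity)).and
      (hexp.eventually_gt_atTop G))))).exists
  choose x hx using fun ω : Fin n → A => M.wordCylinder_inter_repeller_nonempty (List.ofFn ω)
  have hnε0 : 0 ≤ n * ε n := mul_nonneg n.cast_nonneg (h2 n)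
  have hu : ∀ ω, 0 ≤ M.birkhoff M.psi n (x ω) + n * ε n := fun ω => by
    have := hN _ (by simpa using hnN) _ (hx ω).1
    rw [List.length_ofFn] at this
    have : 0 ≤ c * n := by positivity
    linarith
  have hv : ∀ ω, 0 ≤ M.birkhoff φ n (x ω) + n * ε n := fun ω =>
    add_nonneg (birkhoff_nonneg hφ0 n (hx ω).2) hnε0
  by_cases hcard : ∀ (a b : ℕ) (F : Finset (Fin n → A)),
      (∀ ω ∈ F, ⌊M.birkhoff M.psi n (x ω) + n * ε n⌋₊ = a ∧
        ⌊M.birkhoff φ n (x ω) + n * ε n⌋₊ = b) →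
      (F.card : ℝ) ≤ Real.exp (s * ((a + 1) + (b + 1)))
  · exfalso
    have h6 := hG _ _ hu hv hcard
    have h7 : M.partitionSum (fun x => -t * (M.psi x + φ x)) n ≤
        ENNReal.ofReal (Real.exp (n * (δ / 2))) * ENNReal.ofReal G := by
      refine le_trans ?_ (mul_le_mul_right h6 _)
      rw [← ENNReal.tsum_mul_left]
      refine ENNReal.tsum_le_tsum fun ω => ?_
      rw [← ENNReal.ofReal_mul (Real.exp_pos _).le, ← Real.exp_add]
      refine ENNReal.ofReal_le_ofReal (Real.exp_le_exp.2 ?_)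
      have h8 := (h5 t n ω _ (hx ω)).2
      rw [abs_of_pos ht] at h8
      rw [lt_div_iff₀ (by positivity)] at hnε
      have : (n : ℝ) * (ε n * (8 * t)) ≤ n * δ := by gcongr
      linarith
    have h8 : ENNReal.ofReal (Real.exp (n * (δ / 2))) * ENNReal.ofReal G ≤
        ENNReal.ofReal (Real.exp (n * δ)) := by
      rw [← ENNReal.ofReal_mul (Real.exp_pos _).le]
      refine ENNReal.ofReal_le_ofReal ?_
      rw [show (n : ℝ) * δ = n * (δ / 2) + n * (δ / 2) by ring, Real.exp_add]
      gcongr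
    exact absurd (hPn.trans_le (h7.trans h8)) (lt_irrefl _)
  · push Not at hcard
    obtain ⟨a, b, F, hF, hcard⟩ := hcard
    refine ⟨n, F.card, a + 1, b + 1, fun i => List.ofFn (F.equivFin.symm i : Fin n → A), hn0,
      by positivity, by positivity, ?_, fun i => List.length_ofFn, fun i z hz => ?_,
      fun i z hz => ?_, hcard.le⟩
    · exact List.ofFn_injective.comp (Subtype.val_injective.comp F.equivFin.symm.injective)
    · have h6 := h3 _ z hz _ (hx _).1
      rw [List.length_ofFn] at h6
      refine h6.trans ?_
      rw [← (hF _ (F.equivFin.symm i).2).1]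
      exact (Nat.lt_floor_add_one _).le
    · have h6 := h4 _ z hz _ (hx _)
      rw [List.length_ofFn] at h6
      refine h6.trans ?_
      rw [← (hF _ (F.equivFin.symm i).2).2]
      exact (Nat.lt_floor_add_one _).le

end ExpandingMarkovMap

/-- A greedy choice of times at which a tail of cost `D k` may be inserted, so that the total
cost `a t` stays below `t * L / s` while infinitely many insertions happen when `b t + κ < E k`. -/
theorem exists_schedule {lam kap L s s₁ : ℝ} (hlam : 0 ≤ lam) (hkap : 0 < kap) (hs : 0 ≤ s)
    (hss : s ≤ s₁) (hL : s₁ * (lam + kap) ≤ L) {E D : ℕ → ℝ} (K : ℕ → ℝ)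
    (hE : Tendsto E atTop atTop) (hED : Tendsto (fun k => s₁ * E k - s * D k) atTop atTop) :
    ∃ (d : ℕ → Option ℕ) (a b : ℕ → ℝ), a 0 = 0 ∧ b 0 = 0 ∧
      (∀ t, a (t + 1) = a t + (lam + (d t).elim 0 D)) ∧
      (∀ t, b (t + 1) = b t + (kap + (d t).elim 0 K)) ∧
      (∀ t, s * a t ≤ t * L) ∧ (∀ t k, d t = some k → b t + kap < E k) ∧
      ∀ t₀, ∃ t, t₀ ≤ t ∧ ∃ k, d t = some k := by
  classical
  have hL0 : 0 ≤ L := (mul_nonneg (hs.trans hss) (by positivity)).trans hL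
  have hsL : s * lam ≤ L := by nlinarith
  let Q : ℕ → ℝ × ℝ → ℕ → Prop := fun t p k =>
    s * (p.1 + (lam + D k)) ≤ (t + 1 : ℕ) * L ∧ p.2 + kap < E k
  let c : ℕ → ℝ × ℝ → Option ℕ := fun t p => if h : ∃ k, Q t p k then some h.choose else none
  have hc_some : ∀ t p k, c t p = some k → Q t p k := by
    intro t p k h
    by_cases h' : ∃ k, Q t p k
    · simp only [c, dif_pos h', Option.some.injEq] at h
      exact h ▸ h'.choose_spec
    · simp [c, dif_neg h'] at h
  have hc_none : ∀ t p, c t p = none → ∀ k, ¬ Q t p k := by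
    intro t p h k hk
    have h' : ∃ k, Q t p k := ⟨k, hk⟩
    simp [c, dif_pos h'] at h
  let F : ℕ → ℝ × ℝ → ℝ × ℝ := fun t p =>
    (p.1 + (lam + (c t p).elim 0 D), p.2 + (kap + (c t p).elim 0 K))
  obtain ⟨st, hst0, hst⟩ : ∃ st : ℕ → ℝ × ℝ, st 0 = 0 ∧ ∀ t, st (t + 1) = F t (st t) :=
    ⟨fun t => Nat.rec 0 F t, rfl, fun t => rfl⟩
  refine ⟨fun t => c t (st t), fun t => (st t).1, fun t => (st t).2, by simp [hst0],
    by simp [hst0], fun t => congrArg Prod.fst (hst t), fun t => congrArg Prod.snd (hst t), fun t => ?_,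
    fun t k h => (hc_some _ _ _ h).2, fun t₀ => ?_⟩
  · induction t with
    | zero => simp [hst0]
    | succ t ih =>
      simp only [hst, F]
      rcases h : c t (st t) with _ | k
      · push_cast
        simp only [Option.elim]
        nlinarith
      · exact (hc_some _ _ _ h).1
  · by_contra! hcon
    have hnone : ∀ t, t₀ ≤ t → c t (st t) = none := fun t ht =>
      Option.eq_none_iff_forall_ne_some.2 (hcon t ht)
    have hst' : ∀ r : ℕ, st (t₀ + r) = ((st t₀).1 + r * lam, (st t₀).2 + r * kap) := by
      intro r
      induction r with
      | zero => simp
      | succ r ih =>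
        have h := hst (t₀ + r)
        simp only [F, hnone _ (Nat.le_add_right t₀ r), Option.elim] at h
        rw [← add_assoc, h, ih]
        push_cast
        ext <;> ring
    obtain ⟨k, hk1, hk2⟩ := ((hE.eventually_ge_atTop ((st t₀).2 + kap * 2)).and
      (hED.eventually_ge_atTop (s * (st t₀).1 + s₁ * ((st t₀).2 + kap)))).exists
    have hX : 2 ≤ (E k - (st t₀).2) / kap := by
      rw [le_div_iff₀ hkap]; linarith
    obtain ⟨r, hr⟩ : ∃ r, ⌈(E k - (st t₀).2) / kap⌉₊ = r + 2 :=
      Nat.exists_eq_add_of_le' (by exact_mod_cast hX.trans (Nat.le_ceil _))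
    have hr1 : (r + 1 : ℝ) * kap < E k - (st t₀).2 := by
      have := Nat.ceil_lt_add_one (show 0 ≤ (E k - (st t₀).2) / kap by linarith)
      rw [hr] at this
      push_cast at this
      rw [← lt_div_iff₀ hkap]
      linarith
    have hr2 : E k - (st t₀).2 ≤ (r + 2 : ℝ) * kap := by
      have := Nat.le_ceil ((E k - (st t₀).2) / kap)
      rw [hr] at this
      push_cast at this
      rwa [← div_le_iff₀ hkap]
    refine hc_none _ _ (hnone (t₀ + r) (Nat.le_add_right _ _)) k ⟨?_, ?_⟩
    · rw [hst']
      push_cast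
      have e1 : (r + 1 : ℝ) * (s₁ * (lam + kap)) ≤ (r + 1) * L := by gcongr
      have e2 : (0:ℝ) ≤ t₀ * L := by positivity
      have e3 : s₁ * (E k - (st t₀).2) ≤ s₁ * ((r + 2) * kap) :=
        mul_le_mul_of_nonneg_left hr2 (hs.trans hss)
      have e4 : s * ((r + 1) * lam) ≤ s₁ * ((r + 1) * lam) :=
        mul_le_mul_of_nonneg_right hss (by positivity)
      linarith
    · rw [hst']
      push_cast
      linarith

namespace ExpandingMarkovMap

variable {A : Type} {M : ExpandingMarkovMap A}

/-- Words `Y k ++ w`, where `Y k` is the itinerary of `y`, together with the geometric data needed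
to approximate `y`. -/
theorem exists_targets {φ : ℝ → ℝ} (hφ : M.Tempered φ) {y : ℝ} (hy : y ∈ M.repeller) (w : List A)
    {s s₁ : ℝ} (hss : s < s₁) :
    ∃ (Y : ℕ → List A) (E D K : ℕ → ℝ), (∀ k, 0 ≤ D k) ∧ Tendsto E atTop atTop ∧
      Tendsto (fun k => s₁ * E k - s * D k) atTop atTop ∧
      (∀ k, ∀ x ∈ M.wordCylinder (Y k), |x - y| ≤ Real.exp (-E k)) ∧
      (∀ k, ∀ x ∈ M.wordCylinder (Y k ++ w), M.birkhoff M.psi (Y k ++ w).length x ≤ D k) ∧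
      (∀ k, ∀ x ∈ M.wordCylinder (Y k ++ w) ∩ M.repeller,
        M.birkhoff φ (Y k ++ w).length x ≤ K k) := by
  obtain ⟨ε, h1, h2, h3, h4⟩ := hφ.exists_common_distortion
  obtain ⟨c, hc, N, hN⟩ := M.exists_mul_length_le_birkhoff_psi
  choose i hi using fun n => mem_iUnion.1 (hy n)
  obtain ⟨C, hC⟩ := M.exists_birkhoff_psi_le w
  set Y : ℕ → List A := fun k => List.ofFn fun ν : Fin k => i ν with hY
  have hYl : ∀ k, (Y k).length = k := fun k => List.length_ofFn
  have hyY : ∀ k, y ∈ M.wordCylinder (Y k) := fun k =>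
    (mem_wordCylinder_ofFn hy).2 fun ν => hi ν
  choose K hK using fun k => hφ.exists_birkhoff_le (Y k ++ w)
  have hD : ∀ᶠ k : ℕ in atTop, c * k ≤ M.birkhoff M.psi k y := by
    filter_upwards [eventually_ge_atTop N] with k hk
    simpa [hYl] using hN (Y k) (by rwa [hYl]) y (hyY k)
  have hlim : ∀ p q : ℝ, 0 < p → Tendsto (fun k : ℕ => (k : ℝ) * (p * c - q * ε k)) atTop atTop := by
    intro p q hp
    refine tendsto_natCast_atTop_atTop.atTop_mul_pos (C := p * c - q * 0) (by simp; positivity) ?_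
    exact tendsto_const_nhds.sub (h1.const_mul q)
  refine ⟨Y, fun k => M.birkhoff M.psi k y - k * ε k,
    fun k => |M.birkhoff M.psi k y| + k * ε k + |C|, K, fun k => ?_, ?_, ?_, fun k x hx => ?_,
    fun k x hx => ?_, hK⟩
  · have := mul_nonneg k.cast_nonneg (h2 k)
    positivity
  · refine tendsto_atTop_mono' _ ?_ (hlim 1 1 one_pos)
    filter_upwards [hD] with k hk
    linarith
  · refine tendsto_atTop_mono' _ ?_ (tendsto_atTop_add_const_right _ (-(s * |C|))
      (hlim (s₁ - s) (s₁ + s) (by linarith)))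
    filter_upwards [hD] with k hk
    have : (0:ℝ) ≤ c * k := by positivity
    rw [abs_of_nonneg (this.trans hk)]
    have := mul_le_mul_of_nonneg_left hk (sub_pos.2 hss).le
    linarith
  · refine (abs_sub_le_exp_neg (E := M.birkhoff M.psi k y - k * ε k) (fun z hz => ?_) hx
      (hyY k)).trans ?_
    · have := h3 _ y (hyY k) z hz
      rw [hYl] at this ⊢
      linarith
    · exact mul_le_of_le_one_right (Real.exp_pos _).le (abs_iterate_sub_le_one hx (hyY k))
  · rw [mem_wordCylinder_append] at hx
    rw [List.length_append, birkhoff_add]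
    have e1 := h3 _ x hx.1 y (hyY k)
    have e2 := hC _ hx.2
    rw [hYl] at e1 e2 ⊢
    have := le_abs_self (M.birkhoff M.psi k y)
    have := le_abs_self C
    linarith

end ExpandingMarkovMap

open MeasureTheory in
/-- A mass distribution principle for images of the full shift `ℕ → Fin b`. -/
theorem ofReal_le_dimH_range {b : ℕ} {π : (ℕ → Fin b) → ℝ} (hπ : Measurable π) (hb : 0 < b)
    {s : ℝ} (hs : 0 < s) {a : ℕ → ℝ} (ha0 : a 0 = 0) (ha : Tendsto a atTop atTop)
    (hsa : ∀ t, s * a t ≤ t * Real.log b)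
    (hsep : ∀ t c₁ c₂ c₃, (∃ i < t, c₁ i ≠ c₂ i) → (∃ i < t, c₁ i ≠ c₃ i) →
      (∃ i < t, c₂ i ≠ c₃ i) → ∃ p ∈ ({π c₁, π c₂, π c₃} : Set ℝ),
        ∃ q ∈ ({π c₁, π c₂, π c₃} : Set ℝ), Real.exp (-a t) ≤ q - p) :
    ENNReal.ofReal s ≤ dimH (range π) := by
  have : NeZero b := ⟨hb.ne'⟩
  have hb' : (0:ℝ) < b := by exact_mod_cast hb
  let μ : Measure (ℕ → Fin b) :=
    Measure.infinitePi fun _ => ProbabilityTheory.uniformOn (univ : Set (Fin b))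
  have hcyl : ∀ (c : ℕ → Fin b) (t : ℕ),
      μ {c' | ∀ i < t, c' i = c i} = ENNReal.ofReal (Real.exp (-(t * Real.log b))) := by
    intro c t
    have h1 : {c' : ℕ → Fin b | ∀ i < t, c' i = c i} =
        Set.pi (Finset.range t : Set ℕ) fun i => {c i} := by
      ext c'; simp
    rw [h1, Measure.infinitePi_pi _ fun i _ => measurableSet_singleton _]
    simp only [ProbabilityTheory.uniformOn_univ, Measure.count_singleton, Finset.prod_const,
      Finset.card_range, Fintype.card_fin]
    rw [Real.exp_neg, Real.exp_nat_mul, Real.exp_log hb', ← inv_pow,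
      ENNReal.ofReal_pow (by positivity), ENNReal.ofReal_inv_of_pos hb', ENNReal.ofReal_natCast,
      one_div]
  have hball : ∀ (t : ℕ) (E : Set ℝ), Metric.ediam E < ENNReal.ofReal (Real.exp (-a t)) →
      μ (π ⁻¹' E) ≤ ENNReal.ofReal (2 * Real.exp (-(t * Real.log b))) := by
    intro t E hE
    have hsub : ∃ c₁ c₂ : ℕ → Fin b,
        π ⁻¹' E ⊆ {c' | ∀ i < t, c' i = c₁ i} ∪ {c' | ∀ i < t, c' i = c₂ i} := by
      rcases (π ⁻¹' E).eq_empty_or_nonempty with h | ⟨c₁, h₁⟩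
      · exact ⟨fun _ => 0, fun _ => 0, by simp [h]⟩
      by_cases h : ∃ c₂ ∈ π ⁻¹' E, ∃ i < t, c₁ i ≠ c₂ i
      · obtain ⟨c₂, h₂, h₁₂⟩ := h
        refine ⟨c₁, c₂, fun c₃ h₃ => ?_⟩
        by_contra hc
        simp only [mem_union, mem_ofPred_eq, not_or] at hc
        push Not at hc
        obtain ⟨p, hp, q, hq, hpq⟩ := hsep t c₁ c₂ c₃ h₁₂
          (hc.1.imp fun i hi => ⟨hi.1, hi.2.symm⟩) (hc.2.imp fun i hi => ⟨hi.1, hi.2.symm⟩)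
        have hmem : ∀ z ∈ ({π c₁, π c₂, π c₃} : Set ℝ), z ∈ E := by
          rintro z (rfl | rfl | rfl)
          exacts [h₁, h₂, h₃]
        have h4 := (Metric.edist_le_ediam_of_mem (hmem q hq) (hmem p hp)).trans_lt hE
        rw [edist_dist, Real.dist_eq] at h4
        exact h4.not_ge (ENNReal.ofReal_le_ofReal (hpq.trans (le_abs_self _)))
      · push Not at h
        exact ⟨c₁, c₁, fun c₂ h₂ => Or.inl fun i hi => (h c₂ h₂ i hi).symm⟩
    obtain ⟨c₁, c₂, h⟩ := hsub
    refine (measure_mono h).trans ((measure_union_le _ _).trans_eq ?_)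
    rw [hcyl, hcyl, ← ENNReal.ofReal_add (Real.exp_pos _).le (Real.exp_pos _).le, two_mul]
  have hpow : ∀ E : Set ℝ, Metric.ediam E ≤ ENNReal.ofReal (1 / 2) →
      μ (π ⁻¹' E) ≤ ENNReal.ofReal (2 * b) * Metric.ediam E ^ s := by
    intro E hE
    obtain ⟨r, hr0, hr⟩ : ∃ r : ℝ, 0 ≤ r ∧ Metric.ediam E = ENNReal.ofReal r :=
      ⟨_, ENNReal.toReal_nonneg, (ENNReal.ofReal_toReal (hE.trans_lt ENNReal.ofReal_lt_top).ne).symm⟩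
    rw [hr, ENNReal.ofReal_le_ofReal_iff (by norm_num)] at hE
    have hexp : Tendsto (fun t => Real.exp (-a t)) atTop (𝓝 0) :=
      Real.tendsto_exp_neg_atTop_nhds_zero.comp ha
    rcases hr0.eq_or_lt with rfl | hr0
    · refine le_of_eq_of_le (le_antisymm ?_ zero_le) zero_le
      have hlim : Tendsto (fun t => ENNReal.ofReal (2 * Real.exp (-a t) ^ s)) atTop (𝓝 0) := by
        have := ENNReal.tendsto_ofReal
          (((hexp.rpow_const (Or.inr hs.le)).const_mul 2))
        simpa [Real.zero_rpow hs.ne'] using this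
      refine ge_of_tendsto' hlim fun t => (hball t E ?_).trans (ENNReal.ofReal_le_ofReal ?_)
      · rw [hr]
        exact ENNReal.ofReal_lt_ofReal_iff (Real.exp_pos _) |>.2 (Real.exp_pos _)
      · rw [← Real.exp_mul]
        have := hsa t
        gcongr
        linarith
    · have hex : ∃ t, Real.exp (-a t) ≤ r := (hexp.eventually_le_const hr0).exists
      classical
      obtain ⟨t, ht⟩ : ∃ t, Nat.find hex = t + 1 := Nat.exists_eq_succ_of_ne_zero fun h0 => by
        have := Nat.find_spec hex
        rw [h0, ha0] at this
        norm_num at this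
        linarith
      have h1 := Nat.find_spec hex
      have h2 := Nat.find_min hex (m := t) (by omega)
      rw [ht] at h1
      rw [not_le] at h2
      refine (hball t E ?_).trans ?_
      · rw [hr]
        exact (ENNReal.ofReal_lt_ofReal_iff (Real.exp_pos _)).2 h2
      · rw [hr, ENNReal.ofReal_rpow_of_pos hr0, ← ENNReal.ofReal_mul (by positivity)]
        refine ENNReal.ofReal_le_ofReal ?_
        rw [mul_assoc]
        refine mul_le_mul_of_nonneg_left ?_ (by norm_num)
        calc Real.exp (-(t * Real.log b))
            = b * Real.exp (-((t + 1 : ℕ) * Real.log b)) := by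
              rw [← Real.exp_log hb', ← Real.exp_add, Real.log_exp]
              push_cast
              ring_nf
          _ ≤ b * Real.exp (-a (t + 1)) ^ s := by
              rw [← Real.exp_mul]
              have := hsa (t + 1)
              gcongr
              linarith
          _ ≤ b * r ^ s := by gcongr
  have hle : (ENNReal.ofReal (2 * b))⁻¹ • μ.map π ≤ μH[s] := by
    refine Measure.le_hausdorffMeasure s _ (ENNReal.ofReal (1 / 2)) (by simp) fun E hE => ?_
    rw [Measure.smul_apply, smul_eq_mul]
    refine (ENNReal.inv_mul_le_iff (by simpa using hb.ne') ENNReal.ofReal_ne_top).2 ?_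
    refine (measure_mono subset_closure).trans ?_
    rw [Measure.map_apply hπ isClosed_closure.measurableSet]
    refine (hpow _ ?_).trans_eq ?_
    · rw [Metric.ediam_closure]
      exact hE
    · rw [Metric.ediam_closure]
  have hpos : μH[s] (range π) ≠ 0 := by
    refine ((ENNReal.inv_pos.2 (ENNReal.ofReal_ne_top (r := 2 * b))).trans_le
      (le_trans ?_ (hle (range π)))).ne'
    rw [Measure.smul_apply, smul_eq_mul]
    refine le_mul_of_one_le_right' ?_
    refine le_trans ?_ (Measure.le_map_apply hπ.aemeasurable _)
    rw [preimage_range, measure_univ]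
  have := le_dimH_of_hausdorffMeasure_ne_zero (s := range π) (d := s.toNNReal)
    (by rwa [Real.coe_toNNReal _ hs.le])
  exact this

/-- The word obtained by concatenating the blocks `B (c 0), τ 0, …, B (c (t-1)), τ (t-1)`. -/
def codeWord {A : Type} {b : ℕ} (B : Fin b → List A) (τ : ℕ → List A) (c : ℕ → Fin b) :
    ℕ → List A
  | 0 => []
  | t + 1 => codeWord B τ c t ++ (B (c t) ++ τ t)

section codeWord

variable {A : Type} {b n : ℕ} {B : Fin b → List A} {τ : ℕ → List A}

theorem length_codeWord_eq (hB : ∀ i, (B i).length = n) (c c' : ℕ → Fin b) (t : ℕ) :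
    (codeWord B τ c t).length = (codeWord B τ c' t).length := by
  induction t with
  | zero => rfl
  | succ t ih => simp [codeWord, hB, ih]

theorem le_length_codeWord (hB : ∀ i, (B i).length = n) (hn : 0 < n) (c : ℕ → Fin b) (t : ℕ) :
    t ≤ (codeWord B τ c t).length := by
  induction t with
  | zero => exact Nat.zero_le _
  | succ t ih =>
    simp only [codeWord, List.length_append, hB]
    omega

theorem codeWord_congr {c c' : ℕ → Fin b} {t : ℕ} (h : ∀ i < t, c i = c' i) :
    codeWord B τ c t = codeWord B τ c' t := by
  induction t with
  | zero => rfl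
  | succ t ih => rw [codeWord, codeWord, ih fun i hi => h i (by omega), h t (by omega)]

theorem eq_of_codeWord_eq (hB : ∀ i, (B i).length = n) (hinj : Function.Injective B)
    {c c' : ℕ → Fin b} {t : ℕ} (h : codeWord B τ c t = codeWord B τ c' t) :
    ∀ i < t, c i = c' i := by
  induction t with
  | zero => simp
  | succ t ih =>
    obtain ⟨h1, h2⟩ := List.append_inj h (length_codeWord_eq hB c c' t)
    have h3 := hinj (List.append_inj h2 (by rw [hB, hB])).1
    intro i hi
    rcases Nat.lt_succ_iff_lt_or_eq.1 hi with hi | rfl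
    exacts [ih h1 i hi, h3]

theorem codeWord_prefix (c : ℕ → Fin b) {t t' : ℕ} (h : t ≤ t') :
    codeWord B τ c t <+: codeWord B τ c t' := by
  induction t', h using Nat.le_induction with
  | base => exact List.prefix_refl _
  | succ t' _ ih => exact ih.trans (List.prefix_append _ _)

end codeWord

namespace ExpandingMarkovMap

variable {A : Type} {M : ExpandingMarkovMap A}

theorem birkhoff_codeWord_le {b : ℕ} {B : Fin b → List A} {τ : ℕ → List A} {f : ℝ → ℝ} {S : Set ℝ}
    (hS : ∀ n, ∀ x ∈ S, M.T^[n] x ∈ S) {α : ℝ} {β a : ℕ → ℝ}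
    (hα : ∀ i, ∀ x ∈ M.wordCylinder (B i) ∩ S, M.birkhoff f (B i).length x ≤ α)
    (hβ : ∀ t, ∀ x ∈ M.wordCylinder (τ t) ∩ S, M.birkhoff f (τ t).length x ≤ β t)
    (ha0 : a 0 = 0) (ha : ∀ t, a (t + 1) = a t + (α + β t)) (c : ℕ → Fin b) (t : ℕ) {x : ℝ}
    (hx : x ∈ M.wordCylinder (codeWord B τ c t) ∩ S) :
    M.birkhoff f (codeWord B τ c t).length x ≤ a t := by
  induction t with
  | zero => simp [codeWord, birkhoff, ha0]
  | succ t ih =>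
    obtain ⟨hx, hxS⟩ := hx
    rw [codeWord, mem_wordCylinder_append, mem_wordCylinder_append] at hx
    rw [codeWord, List.length_append, List.length_append, birkhoff_add, birkhoff_add, ha]
    exact add_le_add (ih ⟨hx.1, hxS⟩) (add_le_add (hα _ _ ⟨hx.2.1, hS _ _ hxS⟩)
      (hβ _ _ ⟨hx.2.2, hS _ _ (hS _ _ hxS)⟩))

variable (M) in
theorem exists_dist_lt_of_wordCylinder {δ : ℝ} (hδ : 0 < δ) : ∃ N : ℕ, ∀ w : List A,
    N ≤ w.length → ∀ x ∈ M.wordCylinder w, ∀ y ∈ M.wordCylinder w, |x - y| < δ := by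
  obtain ⟨c, hc, N, hN⟩ := M.exists_mul_length_le_birkhoff_psi
  have hlim : Tendsto (fun n : ℕ => Real.exp (-(c * n))) atTop (𝓝 0) :=
    Real.tendsto_exp_neg_atTop_nhds_zero.comp (tendsto_natCast_atTop_atTop.const_mul_atTop hc)
  obtain ⟨N', hN'⟩ := eventually_atTop.1 (hlim.eventually_lt_const hδ)
  refine ⟨max N N', fun w hw x hx y hy => ?_⟩
  refine (abs_sub_le_exp_neg (hN w ((le_max_left _ _).trans hw)) hx hy).trans_lt ?_
  exact (mul_le_of_le_one_right (Real.exp_pos _).le (abs_iterate_sub_le_one hx hy)).trans_lt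
    (hN' _ ((le_max_right _ _).trans hw))

/-- The coding map of the full shift on `b` blocks. -/
theorem exists_coding {b n : ℕ} {B : Fin b → List A} {τ : ℕ → List A}
    (hB : ∀ i, (B i).length = n) (hn : 0 < n) {w : List A} {p q : ℝ} (hp : 0 < p) (hq : q < 1)
    (hw : M.openCylinder w ⊆ Icc p q) (hτ : ∀ t₀, ∃ t, t₀ ≤ t ∧ ∃ u, τ t = u ++ w) :
    ∃ π : (ℕ → Fin b) → ℝ, Measurable π ∧ ∀ c t, π c ∈ M.openCylinder (codeWord B τ c t) := by
  have hex : ∀ c : ℕ → Fin b, ∃ x, ∀ t, x ∈ M.openCylinder (codeWord B τ c t) := by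
    intro c
    refine exists_forall_mem_openCylinder hp hq hw (codeWord B τ c)
      (fun t => codeWord_prefix c t.le_succ) fun t₀ => ?_
    obtain ⟨t, ht, u, hu⟩ := hτ t₀
    exact ⟨t + 1, codeWord B τ c t ++ (B (c t) ++ u),
      (codeWord_prefix c ht).trans (List.prefix_append _ _), by simp [codeWord, hu]⟩
  choose π hπ using hex
  refine ⟨π, Continuous.measurable (Metric.continuous_iff'.2 fun c δ hδ => ?_), hπ⟩
  obtain ⟨N, hN⟩ := M.exists_dist_lt_of_wordCylinder hδ
  have hopen : IsOpen (Set.pi (Finset.range N : Set ℕ) fun i => {c i}) :=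
    isOpen_set_pi (Finset.range N).finite_toSet fun i _ => isOpen_discrete _
  filter_upwards [hopen.mem_nhds (fun i _ => rfl)] with c' hc'
  rw [Real.dist_eq]
  refine hN _ (le_length_codeWord hB hn c N) _ ?_ _
    (openCylinder_subset_wordCylinder _ (hπ c N))
  rw [← codeWord_congr fun i hi => hc' i (by simpa using hi)]
  exact openCylinder_subset_wordCylinder _ (hπ c' N)

theorem exists_exp_neg_le_sub {u₁ u₂ u₃ : List A} (h₂ : u₂.length = u₁.length)
    (h₃ : u₃.length = u₁.length) (h₁₂ : u₁ ≠ u₂) (h₁₃ : u₁ ≠ u₃) (h₂₃ : u₂ ≠ u₃) {L : ℝ}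
    (hL : ∀ u ∈ ({u₁, u₂, u₃} : Set (List A)), ∀ x ∈ M.wordCylinder u,
      M.birkhoff M.psi u.length x ≤ L) {x₁ x₂ x₃ : ℝ} (m₁ : x₁ ∈ M.openCylinder u₁)
    (m₂ : x₂ ∈ M.openCylinder u₂) (m₃ : x₃ ∈ M.openCylinder u₃) :
    ∃ p ∈ ({x₁, x₂, x₃} : Set ℝ), ∃ q ∈ ({x₁, x₂, x₃} : Set ℝ), Real.exp (-L) ≤ q - p := by
  obtain ⟨p, hp, q, hq, h⟩ := exists_subset_Ioo_of_pairwise_disjoint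
    (ordConnected_openCylinder u₁) (ordConnected_openCylinder u₂) (ordConnected_openCylinder u₃)
    (disjoint_openCylinder h₂.symm h₁₂) (disjoint_openCylinder h₃.symm h₁₃)
    (disjoint_openCylinder (h₂.trans h₃.symm) h₂₃) m₁ m₂ m₃
  refine ⟨p, hp, q, hq, ?_⟩
  rcases h with h | h | h <;>
  exact exp_neg_le_of_openCylinder_subset (hL _ (by simp)) (h.trans Ioo_subset_Icc_self)

theorem ofReal_le_dimH_shrinkingTarget {φ : ℝ → ℝ} (hφ0 : ∀ x ∈ M.repeller, 0 ≤ φ x)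
    (hφ : M.Tempered φ) {y : ℝ} (hy : y ∈ M.repeller) {s t : ℝ} (hs : 0 < s) (hst : s < t)
    (hP : ¬ M.pressure (fun x => -t * (M.psi x + φ x)) ≤ 0) :
    ENNReal.ofReal s ≤ dimH (M.shrinkingTarget y φ) := by
  obtain ⟨s₁, hs₁, hs₁t⟩ := exists_between hst
  obtain ⟨n, b, lam, kap, B, hn, hlam, hkap, hinj, hB, hBψ, hBφ, hcard⟩ :=
    exists_injective_blocks hφ0 hφ (hs.trans hst) hs₁t hP
  obtain ⟨w, -, p, q, hp, hq, hw⟩ := M.exists_openCylinder_subset_Icc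
  obtain ⟨Y, E, D, K, hD0, hE, hED, hYE, hYD, hYK⟩ := exists_targets hφ hy w hs₁
  have hb : (0:ℝ) < b := (Real.exp_pos _).trans_le hcard
  obtain ⟨d, a, a', ha0, ha'0, ha, ha', hsa, hdE, hd⟩ := exists_schedule hlam.le hkap hs.le hs₁.le
    ((Real.le_log_iff_exp_le hb).2 hcard) K hE hED
  set τ : ℕ → List A := fun t => (d t).elim [] fun k => Y k ++ w with hτ
  have hτ_some : ∀ {t k}, d t = some k → τ t = Y k ++ w := fun h => by simp [hτ, h]
  obtain ⟨π, hπ, hmem⟩ := exists_coding (M := M) (τ := τ) hB hn hp hq hw fun t₀ => by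
    obtain ⟨t, ht, k, hk⟩ := hd t₀
    exact ⟨t, ht, Y k, hτ_some hk⟩
  have hmem' : ∀ c t, π c ∈ M.wordCylinder (codeWord B τ c t) := fun c t =>
    openCylinder_subset_wordCylinder _ (hmem c t)
  have hψ : ∀ c t, ∀ x ∈ M.wordCylinder (codeWord B τ c t),
      M.birkhoff M.psi (codeWord B τ c t).length x ≤ a t := fun c t x hx =>
    birkhoff_codeWord_le (S := univ) (fun _ _ _ => mem_univ _)
      (fun i x hx => by rw [hB]; exact hBψ i x hx.1)
      (fun t x hx => by
        rcases h : d t with _ | k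
        · simp [hτ, h, birkhoff]
        · rw [hτ_some h] at hx ⊢
          exact hYD k x hx.1) ha0 ha c t ⟨hx, mem_univ _⟩
  have hφ' : ∀ c t, ∀ x ∈ M.wordCylinder (codeWord B τ c t) ∩ M.repeller,
      M.birkhoff φ (codeWord B τ c t).length x ≤ a' t := fun c t x hx =>
    birkhoff_codeWord_le (fun n x hx => iterate_mem_repeller hx n)
      (fun i x hx => by rw [hB]; exact hBφ i x hx)
      (fun t x hx => by
        rcases h : d t with _ | k
        · simp [hτ, h, birkhoff]
        · rw [hτ_some h] at hx ⊢
          exact hYK k x hx) ha'0 ha' c t hx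
  have hrep : ∀ c, π c ∈ M.repeller := fun c => mem_repeller_of_forall fun m =>
    ⟨_, (Nat.lt_succ_self m).trans_le (le_length_codeWord hB hn c (m + 1)), hmem' c _⟩
  have hsub : range π ⊆ M.shrinkingTarget y φ := by
    rintro _ ⟨c, rfl⟩
    refine mem_iInter.2 fun m => ?_
    obtain ⟨t, ht, k, hk⟩ := hd m
    have h1 := hmem' c (t + 1)
    rw [codeWord, mem_wordCylinder_append, mem_wordCylinder_append, hτ_some hk,
      mem_wordCylinder_append, hB, ← Function.iterate_add_apply, add_comm n] at h1
    refine mem_iUnion₂.2 ⟨(codeWord B τ c t).length + n,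
      ht.trans ((le_length_codeWord hB hn c t).trans (Nat.le_add_right _ _)), hrep c, ?_⟩
    refine (hYE k _ h1.2.2.1).trans_lt (Real.exp_lt_exp.2 (neg_lt_neg ?_))
    rw [birkhoff_add]
    exact (add_le_add (hφ' c t _ ⟨h1.1, hrep c⟩)
      (hBφ _ _ ⟨h1.2.1, iterate_mem_repeller (hrep c) _⟩)).trans_lt (hdE t k hk)
  have halim : Tendsto a atTop atTop := by
    refine tendsto_atTop_mono (fun t => ?_) (tendsto_natCast_atTop_atTop.atTop_mul_const hlam)
    induction t with
    | zero => simp [ha0]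
    | succ t ih =>
      have : 0 ≤ (d t).elim 0 D := by
        rcases d t with _ | k
        exacts [le_rfl, hD0 k]
      rw [ha]
      push_cast
      linarith
  refine (ofReal_le_dimH_range hπ (by exact_mod_cast hb) hs ha0 halim hsa
    fun t c₁ c₂ c₃ h₁₂ h₁₃ h₂₃ => ?_).trans (dimH_mono hsub)
  have hne : ∀ {c c' : ℕ → Fin b}, (∃ i < t, c i ≠ c' i) →
      codeWord B τ c t ≠ codeWord B τ c' t := fun ⟨i, hi, h⟩ h' =>
    h (eq_of_codeWord_eq hB hinj h' i hi)
  refine exists_exp_neg_le_sub (length_codeWord_eq hB _ _ t) (length_codeWord_eq hB _ _ t)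
    (hne h₁₂) (hne h₁₃) (hne h₂₃) ?_ (hmem c₁ t) (hmem c₂ t) (hmem c₃ t)
  rintro u (rfl | rfl | rfl)
  exacts [hψ _ t, hψ _ t, hψ _ t]

end ExpandingMarkovMap

/-- For an expanding Markov map `T` with repeller `Λ` and a non-negative potential `φ`
satisfying the tempered distortion condition, for every `y ∈ Λ`, `dim D_y(φ) = s(φ)`. -/
theorem dimH_shrinkingTarget_eq_of_mem_repeller {A : Type} (M : ExpandingMarkovMap A)
    (φ : ℝ → ℝ) (hφ0 : ∀ x ∈ M.repeller, 0 ≤ φ x) (hφ : M.Tempered φ)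
    (y : ℝ) (hy : y ∈ M.repeller) :
    dimH (M.shrinkingTarget y φ) = ENNReal.ofReal (M.sdim φ) := by
  have hlim : Tendsto ENNReal.ofReal (𝓝 (M.sdim φ)) (𝓝 (ENNReal.ofReal (M.sdim φ))) :=
    ENNReal.continuous_ofReal.tendsto _
  have hbdd : BddBelow {s : ℝ | M.pressure (fun x => -s * (M.psi x + φ x)) ≤ 0} :=
    ⟨0, fun s hs => ExpandingMarkovMap.nonneg_of_pressure_nonpos hφ0 hφ hs⟩
  refine le_antisymm ?_ ?_
  · refine ge_of_tendsto (hlim.mono_left nhdsWithin_le_nhds)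
      (eventually_mem_nhdsWithin (s := Ioi (M.sdim φ)) |>.mono fun t ht => ?_)
    obtain ⟨s, hs, hst⟩ := exists_lt_of_csInf_lt
      ⟨1, ExpandingMarkovMap.pressure_neg_nonpos hφ0 hφ⟩ (mem_Ioi.1 ht)
    exact ExpandingMarkovMap.dimH_shrinkingTarget_le hφ0 hφ y hs hst
  · refine le_of_tendsto (hlim.mono_left nhdsWithin_le_nhds)
      (eventually_mem_nhdsWithin (s := Iio (M.sdim φ)) |>.mono fun s hs => ?_)
    rcases le_or_gt s 0 with hs0 | hs0
    · simp [ENNReal.ofReal_of_nonpos hs0]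
    · obtain ⟨t, hst, ht⟩ := exists_between (mem_Iio.1 hs)
      exact ExpandingMarkovMap.ofReal_le_dimH_shrinkingTarget hφ0 hφ hy hs0 hst
        fun h => (csInf_le hbdd h).not_gt ht
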